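/- Let N ≥ 3, n ≥ 0, let (L_{ij})_{1≤i<j≤N} be a Lagrangian 2-form (each L_{ij} a jet function of order n, with L_{ji} := −L_{ij}), and let u: ℝ^N → ℝ be smooth. For p ∈ ℝ^N, distinct indices i, j, k, and a_i, a_j, a_k > 0, the associated 3-flower consists of the three petals S_{ij} := {p + s·e_i + t·e_j : 0 ≤ s ≤ a_i, 0 ≤ t ≤ a_j}, S_{jk} and S_{ki} (defined cyclically), with action A(w) := ∫₀^{a_i}∫₀^{a_j} L_{ij}[w](p+s·e_i+t·e_j) dt ds + ∫₀^{a_j}∫₀^{a_k} L_{jk}[w](p+s·e_j+t·e_k) dt ds + ∫₀^{a_k}∫₀^{a_i} L_{ki}[w](p+s·e_k+t·e_i) dt ds. Then the following are equivalent: (1) for every such 3-flower and every smooth φ: ℝ^N → ℝ with compact support disjoint from the outer edges of the three petals (all rectangle edges except the three interior segments {p+s·e_i : 0≤s≤a_i}, {p+s·e_j : 0≤s≤a_j}, {p+s·e_k : 0≤s≤a_k}), one has d/dε|_{ε=0} A(u+εφ) = 0; (2) u satisfies everywhere on ℝ^N: (δ_{ij}L_{ij}/δu_I)[u] = 0 for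 all distinct i, j and every I with I_i = I_j = 0; (δ_{ij}L_{ij}/δu_{I+e_j})[u] = (δ_{ik}L_{ik}/δu_{I+e_k})[u] for all distinct i, j, k and every I with I_i = 0; and (δ_{ij}L_{ij}/δu_{I+e_i+e_j})[u] + (δ_{jk}L_{jk}/δu_{I+e_j+e_k})[u] + (δ_{ki}L_{ki}/δu_{I+e_k+e_i})[u] = 0 for all distinct i, j, k and every I. -/

import Mathlib

noncomputable section

/-- The partial derivative of `f : ℝ^N → ℝ` in the `i`-th coordinate direction. -/
def pd {N : ℕ} (i : Fin N) (f : (Fin N → ℝ) → ℝ) : (Fin N → ℝ) → ℝ :=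
  fun t => fderiv ℝ f t (Pi.single i 1)

/-- The iterated partial derivative `∂^I = ∂_1^{I_1} ⋯ ∂_N^{I_N}`. -/
def pdMulti {N : ℕ} (I : Fin N → ℕ) (f : (Fin N → ℝ) → ℝ) : (Fin N → ℝ) → ℝ :=
  ((List.ofFn fun m : Fin N => (pd m)^[I m]).foldr (· ∘ ·) id) f

/-- The `i`-th coordinate unit vector in `ℝ^N`. -/
def unitVec {N : ℕ} (i : Fin N) : Fin N → ℝ := Pi.single i 1

instance jetFintype (N n : ℕ) : Fintype {I : Fin N → ℕ // ∑ m, I m ≤ n} :=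
  Fintype.ofInjective
    (fun I => (fun m => (⟨I.1 m, Nat.lt_succ_of_le
      ((Finset.single_le_sum (f := I.1) (fun _ _ => Nat.zero_le _)
        (Finset.mem_univ m)).trans I.2)⟩ : Fin (n + 1))) : _ → (Fin N → Fin (n + 1)))
    (fun I J h => Subtype.ext (funext fun m => congrArg Fin.val (congrFun h m)))

/-- The space of jet variables `(u_I)_{|I| ≤ n}` of order `n`. -/
abbrev JetSpace (N n : ℕ) := {I : Fin N → ℕ // ∑ m, I m ≤ n} → ℝ

/-- The `n`-jet of a field `w` at the point `t`. -/
def jet {N : ℕ} (n : ℕ) (w : (Fin N → ℝ) → ℝ) (t : Fin N → ℝ) : JetSpace N n :=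
  fun I => pdMulti I.1 w t

/-- Evaluation `L[w]` of a jet function on the jet of a field `w`. -/
def jev {N n : ℕ} (L : JetSpace N n → ℝ) (w : (Fin N → ℝ) → ℝ) : (Fin N → ℝ) → ℝ :=
  fun t => L (jet n w t)

/-- `(∂L/∂u_I)[w]`: the partial derivative of the jet function `L` with respect to the jet
variable `u_I`, evaluated on the jet of `w` (zero when `|I| > n`). -/
def pjet {N n : ℕ} (L : JetSpace N n → ℝ) (I : Fin N → ℕ) (w : (Fin N → ℝ) → ℝ) :
    (Fin N → ℝ) → ℝ :=
  fun t => if h : ∑ m, I m ≤ n then fderiv ℝ L (jet n w t) (Pi.single ⟨I, h⟩ 1) else 0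

/-- The two-direction variational derivative
`(δ_{ij}L/δu_I)[w] = Σ_{α,β} (−1)^{α+β} D_i^α D_j^β ((∂L/∂u_{I+α·e_i+β·e_j})[w])`. -/
def varDer2 {N n : ℕ} (i j : Fin N) (L : JetSpace N n → ℝ) (I : Fin N → ℕ)
    (w : (Fin N → ℝ) → ℝ) : (Fin N → ℝ) → ℝ :=
  ∑ᶠ α : ℕ, ∑ᶠ β : ℕ, (-1 : ℝ) ^ (α + β) •
    (pd i)^[α] ((pd j)^[β] (pjet L (I + α • Pi.single i 1 + β • Pi.single j 1) w))

/-- The coordinate segment `{q + s·e_d : s ∈ [0, a]}`. -/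
def seg {N : ℕ} (q : Fin N → ℝ) (d : Fin N) (a : ℝ) : Set (Fin N → ℝ) :=
  (fun s : ℝ => q + s • unitVec d) '' Set.Icc 0 a

/-- The action of the field `w` on the coordinate rectangle (petal)
`{p + s·e_i + t·e_j : 0 ≤ s ≤ ai, 0 ≤ t ≤ aj}` with Lagrangian coefficient `L i j`. -/
def petalAction {N n : ℕ} (L : Fin N → Fin N → JetSpace N n → ℝ)
    (w : (Fin N → ℝ) → ℝ) (p : Fin N → ℝ) (i j : Fin N) (ai aj : ℝ) : ℝ :=
  ∫ s in (0:ℝ)..ai, ∫ t in (0:ℝ)..aj,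
    jev (L i j) w (p + s • unitVec i + t • unitVec j)

/-- The two outer edges of the petal `{p + s·e_i + t·e_j : 0 ≤ s ≤ ai, 0 ≤ t ≤ aj}`
(the edges not meeting the flower's center `p`). -/
def petalOuter {N : ℕ} (p : Fin N → ℝ) (i j : Fin N) (ai aj : ℝ) : Set (Fin N → ℝ) :=
  seg (p + ai • unitVec i) j aj ∪ seg (p + aj • unitVec j) i ai


/-- Smooth fields. -/
abbrev Sm {N : ℕ} (f : (Fin N → ℝ) → ℝ) : Prop := ContDiff ℝ (⊤ : ℕ∞) f

theorem Sm.pd {N : ℕ} {f : (Fin N → ℝ) → ℝ} (hf : Sm f) (i : Fin N) : Sm (pd i f) := by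
  have h : ContDiff ℝ (⊤ : ℕ∞) (fderiv ℝ f) := hf.fderiv_right (by exact_mod_cast le_refl _)
  exact h.clm_apply contDiff_const

theorem Sm.diff {N : ℕ} {f : (Fin N → ℝ) → ℝ} (hf : Sm f) : Differentiable ℝ f :=
  hf.differentiable (by simp)

theorem Sm.pd_iter {N : ℕ} {f : (Fin N → ℝ) → ℝ} (hf : Sm f) (i : Fin N) (k : ℕ) :
    Sm ((_root_.pd i)^[k] f) := by
  induction k with
  | zero => exact hf
  | succ k ih => rw [Function.iterate_succ_apply']; exact ih.pd i

theorem pd_comm {N : ℕ} {f : (Fin N → ℝ) → ℝ} (hf : Sm f) (i j : Fin N) :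
    pd i (pd j f) = pd j (pd i f) := by
  have h : Differentiable ℝ (fderiv ℝ f) :=
    (hf.fderiv_right (m := (⊤ : ℕ∞)) (by exact_mod_cast le_refl _)).differentiable (by simp)
  have key : ∀ (a b : Fin N) t, pd a (pd b f) t
      = fderiv ℝ (fderiv ℝ f) t (Pi.single a 1) (Pi.single b 1) := by
    intro a b t
    unfold pd
    rw [fderiv_clm_apply (h t) (differentiableAt_const _)]
    simp
  funext t
  rw [key, key]
  exact (hf.contDiffAt.isSymmSndFDerivAt (by simp; exact WithTop.coe_le_coe.2 (le_top : (2 : ℕ∞) ≤ ⊤))).eq _ _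

theorem pd_add {N : ℕ} {f g : (Fin N → ℝ) → ℝ} (hf : Sm f) (hg : Sm g) (i : Fin N) :
    pd i (f + g) = pd i f + pd i g := by
  funext t
  simp only [pd, Pi.add_apply]
  rw [fderiv_add (hf.diff t) (hg.diff t)]; rfl

theorem pd_smul {N : ℕ} {f : (Fin N → ℝ) → ℝ} (hf : Sm f) (c : ℝ) (i : Fin N) :
    pd i (c • f) = c • pd i f := by
  funext t
  simp only [pd, Pi.smul_apply]
  rw [fderiv_const_smul (hf.diff t)]; rfl

theorem pd_zero {N : ℕ} (i : Fin N) : pd i (0 : (Fin N → ℝ) → ℝ) = 0 := by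
  funext t
  simp [pd]

theorem pd_mul {N : ℕ} {f g : (Fin N → ℝ) → ℝ} (hf : Sm f) (hg : Sm g) (i : Fin N) :
    pd i (f * g) = pd i f * g + f * pd i g := by
  funext t
  simp only [pd, Pi.add_apply, Pi.mul_apply]
  rw [fderiv_mul (hf.diff t) (hg.diff t)]; simp; ring

theorem Sm.sum {N : ℕ} {ι : Type*} {s : Finset ι} {f : ι → (Fin N → ℝ) → ℝ}
    (hf : ∀ x, Sm (f x)) : Sm (∑ x ∈ s, f x) := by
  have h := ContDiff.sum (s := s) (fun x _ => hf x)
  have e : (∑ x ∈ s, f x) = fun t => ∑ x ∈ s, f x t := by funext t; simp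
  rw [e]; exact h

theorem pd_sum {N : ℕ} {ι : Type*} {s : Finset ι} {f : ι → (Fin N → ℝ) → ℝ}
    (hf : ∀ x, Sm (f x)) (i : Fin N) : pd i (∑ x ∈ s, f x) = ∑ x ∈ s, pd i (f x) := by
  classical
  induction s using Finset.induction_on with
  | empty => simp [pd_zero]
  | insert a s ha ih => rw [Finset.sum_insert ha, Finset.sum_insert ha, pd_add (hf a) (Sm.sum hf), ih]

theorem Sm.smul {N : ℕ} {f : (Fin N → ℝ) → ℝ} (hf : Sm f) (c : ℝ) : Sm (c • f) :=
  contDiff_const.smul hf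

theorem pd_iter_add {N : ℕ} {f g : (Fin N → ℝ) → ℝ} (hf : Sm f) (hg : Sm g) (i : Fin N) (k : ℕ) :
    (pd i)^[k] (f + g) = (pd i)^[k] f + (pd i)^[k] g := by
  induction k with
  | zero => rfl
  | succ k ih => simp only [Function.iterate_succ_apply']; rw [ih, pd_add (hf.pd_iter i k) (hg.pd_iter i k)]

theorem pd_iter_smul {N : ℕ} {f : (Fin N → ℝ) → ℝ} (hf : Sm f) (c : ℝ) (i : Fin N) (k : ℕ) :
    (pd i)^[k] (c • f) = c • (pd i)^[k] f := by
  induction k with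
  | zero => rfl
  | succ k ih => simp only [Function.iterate_succ_apply']; rw [ih, pd_smul (hf.pd_iter i k)]

theorem pd_iter_zero {N : ℕ} (i : Fin N) (k : ℕ) :
    (pd i)^[k] (0 : (Fin N → ℝ) → ℝ) = 0 := by
  induction k with
  | zero => rfl
  | succ k ih => simp only [Function.iterate_succ_apply']; rw [ih, pd_zero]

theorem pd_iter_sum {N : ℕ} {ι : Type*} {s : Finset ι} {f : ι → (Fin N → ℝ) → ℝ}
    (hf : ∀ x, Sm (f x)) (i : Fin N) (k : ℕ) :
    (pd i)^[k] (∑ x ∈ s, f x) = ∑ x ∈ s, (pd i)^[k] (f x) := by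
  induction k with
  | zero => rfl
  | succ k ih =>
    simp only [Function.iterate_succ_apply']; rw [ih, pd_sum (fun x => (hf x).pd_iter i k)]

theorem pd_iter_comm1 {N : ℕ} {f : (Fin N → ℝ) → ℝ} (hf : Sm f) (i j : Fin N) (k : ℕ) :
    pd i ((pd j)^[k] f) = (pd j)^[k] (pd i f) := by
  induction k with
  | zero => rfl
  | succ k ih =>
    simp only [Function.iterate_succ_apply']; rw [pd_comm (hf.pd_iter j k), ih]

theorem pd_iter_comm {N : ℕ} {f : (Fin N → ℝ) → ℝ} (hf : Sm f) (i j : Fin N) (l k : ℕ) :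
    (pd i)^[l] ((pd j)^[k] f) = (pd j)^[k] ((pd i)^[l] f) := by
  induction l with
  | zero => rfl
  | succ l ih =>
    simp only [Function.iterate_succ_apply']; rw [ih, pd_iter_comm1 (hf.pd_iter i l)]

/-- The list version of the iterated partial derivative. -/
def pdL {N : ℕ} (I : Fin N → ℕ) (l : List (Fin N)) (f : (Fin N → ℝ) → ℝ) : (Fin N → ℝ) → ℝ :=
  ((l.map fun m : Fin N => (pd m)^[I m]).foldr (· ∘ ·) id) f

theorem pdMulti_eq {N : ℕ} (I : Fin N → ℕ) (f : (Fin N → ℝ) → ℝ) :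
    pdMulti I f = pdL I (List.finRange N) f := by
  unfold pdMulti pdL
  rw [List.ofFn_eq_map]

theorem pdL_nil {N : ℕ} (I : Fin N → ℕ) (f : (Fin N → ℝ) → ℝ) : pdL I [] f = f := rfl

theorem pdL_cons {N : ℕ} (I : Fin N → ℕ) (m : Fin N) (l : List (Fin N)) (f : (Fin N → ℝ) → ℝ) :
    pdL I (m :: l) f = (pd m)^[I m] (pdL I l f) := rfl

theorem Sm.pdL {N : ℕ} {f : (Fin N → ℝ) → ℝ} (hf : Sm f) (I : Fin N → ℕ) (l : List (Fin N)) :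
    Sm (pdL I l f) := by
  induction l with
  | nil => exact hf
  | cons m l ih => rw [pdL_cons]; exact ih.pd_iter _ _

theorem Sm.pdMulti {N : ℕ} {f : (Fin N → ℝ) → ℝ} (hf : Sm f) (I : Fin N → ℕ) :
    Sm (pdMulti I f) := by
  rw [pdMulti_eq]; exact hf.pdL _ _

theorem pdL_not_mem {N : ℕ} (I : Fin N → ℕ) (m : Fin N) (l : List (Fin N)) (hm : m ∉ l)
    (f : (Fin N → ℝ) → ℝ) : pdL (I + Pi.single m 1) l f = pdL I l f := by
  induction l with
  | nil => rfl
  | cons a l ih =>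
    rw [List.mem_cons, not_or] at hm
    rw [pdL_cons, pdL_cons, ih hm.2]
    simp [Pi.single_eq_of_ne (Ne.symm hm.1)]

theorem pdL_mem {N : ℕ} (I : Fin N → ℕ) (m : Fin N) (l : List (Fin N)) (hl : l.Nodup) (hm : m ∈ l)
    {f : (Fin N → ℝ) → ℝ} (hf : Sm f) : pdL (I + Pi.single m 1) l f = pd m (pdL I l f) := by
  induction l with
  | nil => simp at hm
  | cons a l ih =>
    rw [List.nodup_cons] at hl
    rw [pdL_cons, pdL_cons]
    by_cases h : m = a
    · subst h
      rw [pdL_not_mem I m l hl.1]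
      simp only [Pi.add_apply, Pi.single_eq_same, Function.iterate_succ_apply']
    · have hm' : m ∈ l := by simpa [h] using hm
      rw [ih hl.2 hm', pd_iter_comm1 (hf.pdL I l)]
      simp [Pi.single_eq_of_ne (Ne.symm h)]

theorem pdMulti_succ {N : ℕ} (I : Fin N → ℕ) (m : Fin N)
    {f : (Fin N → ℝ) → ℝ} (hf : Sm f) : pdMulti (I + Pi.single m 1) f = pd m (pdMulti I f) := by
  rw [pdMulti_eq, pdMulti_eq]
  exact pdL_mem I m _ (List.nodup_finRange N) (List.mem_finRange m) hf

theorem pdMulti_zero {N : ℕ} (f : (Fin N → ℝ) → ℝ) : pdMulti (0 : Fin N → ℕ) f = f := by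
  rw [pdMulti_eq]
  induction (List.finRange N) with
  | nil => rfl
  | cons m l ih => rw [pdL_cons, ih]; rfl

/-- Induction over multi-indices. -/
theorem multi_induction {N : ℕ} {P : (Fin N → ℕ) → Prop} (h0 : P 0)
    (hs : ∀ I m, P I → P (I + Pi.single m 1)) (I : Fin N → ℕ) : P I := by
  generalize hk : ∑ m, I m = k
  induction k generalizing I with
  | zero =>
    have : I = 0 := by
      funext m
      exact (Finset.sum_eq_zero_iff.mp hk) m (Finset.mem_univ m)
    rw [this]; exact h0
  | succ k ih =>
    have : ∃ m, I m ≠ 0 := by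
      by_contra hcon
      push Not at hcon
      simp [hcon] at hk
    obtain ⟨m, hm⟩ := this
    have e : I = (I - Pi.single m 1) + Pi.single m 1 := by
      funext a
      by_cases h : a = m
      · subst h; simp; omega
      · simp [Pi.single_eq_of_ne h]
    rw [e]
    apply hs
    apply ih
    rw [e] at hk
    simp only [Pi.add_apply, Finset.sum_add_distrib, Finset.sum_pi_single', Finset.mem_univ, if_true] at hk
    omega

theorem pdMulti_add {N : ℕ} {f g : (Fin N → ℝ) → ℝ} (hf : Sm f) (hg : Sm g) (I : Fin N → ℕ) :
    pdMulti I (f + g) = pdMulti I f + pdMulti I g := by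
  induction I using multi_induction with
  | h0 => simp only [pdMulti_zero]
  | hs I m ih =>
    rw [pdMulti_succ (f := f + g) I m (hf.add hg), ih, pdMulti_succ I m hf, pdMulti_succ I m hg,
      pd_add (hf.pdMulti I) (hg.pdMulti I)]

theorem pdMulti_smul {N : ℕ} {f : (Fin N → ℝ) → ℝ} (hf : Sm f) (c : ℝ) (I : Fin N → ℕ) :
    pdMulti I (c • f) = c • pdMulti I f := by
  induction I using multi_induction with
  | h0 => simp only [pdMulti_zero]
  | hs I m ih =>
    rw [pdMulti_succ I m (hf.smul c), ih, pdMulti_succ I m hf, pd_smul (hf.pdMulti I)]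

theorem tsupport_pdMulti {N : ℕ} {f : (Fin N → ℝ) → ℝ} (hf : Sm f) (I : Fin N → ℕ) :
    tsupport (pdMulti I f) ⊆ tsupport f := by
  induction I using multi_induction with
  | h0 => rw [pdMulti_zero]
  | hs I m ih =>
    rw [pdMulti_succ I m hf]
    exact (tsupport_fderiv_apply_subset ℝ _).trans ih

theorem pdMulti_eq_zero {N : ℕ} {f : (Fin N → ℝ) → ℝ} (hf : Sm f) (I : Fin N → ℕ)
    {q : Fin N → ℝ} (hq : q ∉ tsupport f) : pdMulti I f q = 0 :=
  image_eq_zero_of_notMem_tsupport fun h => hq (tsupport_pdMulti hf I h)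

theorem Sm.jet {N : ℕ} {f : (Fin N → ℝ) → ℝ} (hf : Sm f) (n : ℕ) :
    ContDiff ℝ (⊤ : ℕ∞) (jet n f) :=
  contDiff_pi.2 fun I => hf.pdMulti I.1

theorem jet_add_smul {N : ℕ} {f g : (Fin N → ℝ) → ℝ} (hf : Sm f) (hg : Sm g) (n : ℕ) (ε : ℝ)
    (t : Fin N → ℝ) : jet n (f + ε • g) t = jet n f t + ε • jet n g t := by
  funext I
  simp only [_root_.jet, Pi.add_apply, Pi.smul_apply]
  rw [pdMulti_add hf (hg.smul ε), pdMulti_smul hg]; rfl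

theorem Sm.pjet {N n : ℕ} {L : JetSpace N n → ℝ} (hL : ContDiff ℝ (⊤ : ℕ∞) L)
    {w : (Fin N → ℝ) → ℝ} (hw : Sm w) (I : Fin N → ℕ) : Sm (pjet L I w) := by
  unfold _root_.pjet
  by_cases h : ∑ m, I m ≤ n
  · simp only [h, dif_pos]
    have h1 : ContDiff ℝ (⊤ : ℕ∞) (fderiv ℝ L) := hL.fderiv_right (by exact_mod_cast le_refl _)
    exact (h1.comp (hw.jet n)).clm_apply contDiff_const
  · simp only [h, dif_neg, not_false_eq_true]
    exact contDiff_const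

/-- The set of multi-indices of order at most `n`. -/
def boxB (N n : ℕ) : Finset (Fin N → ℕ) :=
  (Finset.univ : Finset {I : Fin N → ℕ // ∑ m, I m ≤ n}).map ⟨Subtype.val, Subtype.val_injective⟩

theorem mem_boxB {N n : ℕ} (I : Fin N → ℕ) : I ∈ boxB N n ↔ ∑ m, I m ≤ n := by
  simp [boxB]

theorem order_add {N : ℕ} (I : Fin N → ℕ) (m : Fin N) :
    ∑ a, (I + Pi.single m 1 : Fin N → ℕ) a = ∑ a, I a + 1 := by
  simp [Finset.sum_add_distrib]

theorem order_add_smul {N : ℕ} (I : Fin N → ℕ) (m : Fin N) (k : ℕ) :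
    ∑ a, (I + k • Pi.single m 1 : Fin N → ℕ) a = ∑ a, I a + k := by
  simp [Finset.sum_add_distrib, ← Finset.mul_sum]

/-- The one-direction variational derivative of a family. -/
def D1 {N : ℕ} (n : ℕ) (i : Fin N) (P : (Fin N → ℕ) → (Fin N → ℝ) → ℝ) (I : Fin N → ℕ) :
    (Fin N → ℝ) → ℝ :=
  ∑ α ∈ Finset.range (n + 1), (-1 : ℝ) ^ α • (pd i)^[α] (P (I + α • Pi.single i 1))

/-- A smooth family of coefficients vanishing above order `n`. -/
structure Fam {N : ℕ} (n : ℕ) (P : (Fin N → ℕ) → (Fin N → ℝ) → ℝ) : Prop where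
  sm : ∀ I, Sm (P I)
  van : ∀ I, n < ∑ m, I m → P I = 0

theorem Fam.pjet {N n : ℕ} {L : JetSpace N n → ℝ} (hL : ContDiff ℝ (⊤ : ℕ∞) L)
    {w : (Fin N → ℝ) → ℝ} (hw : Sm w) : Fam n (fun I => pjet L I w) where
  sm := fun I => Sm.pjet hL hw I
  van := fun I hI => by
    funext t
    simp [_root_.pjet, not_le.2 hI]

theorem Fam.D1 {N n : ℕ} {P : (Fin N → ℕ) → (Fin N → ℝ) → ℝ} (hP : Fam n P) (i : Fin N) :
    Fam n (D1 n i P) where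
  sm := fun I => Sm.sum fun α => ((hP.sm _).pd_iter i α).smul _
  van := fun I hI => by
    unfold _root_.D1
    apply Finset.sum_eq_zero
    intro α _
    rw [hP.van, pd_iter_zero, smul_zero]
    rw [order_add_smul]; omega

theorem Fam.shift {N n : ℕ} {P : (Fin N → ℕ) → (Fin N → ℝ) → ℝ} (hP : Fam n P) (i : Fin N) :
    Fam n (fun I => P (I + Pi.single i 1)) where
  sm := fun I => hP.sm _
  van := fun I hI => hP.van _ (by rw [order_add]; omega)

theorem Fam.ind {N n : ℕ} {P : (Fin N → ℕ) → (Fin N → ℝ) → ℝ} (hP : Fam n P) (i : Fin N) :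
    Fam n (fun I => if I i = 0 then P I else 0) where
  sm := fun I => by
    by_cases h : I i = 0
    · simpa [h] using hP.sm I
    · simp only [h, if_false]; exact contDiff_const
  van := fun I hI => by simp [hP.van I hI]

theorem D1_rec {N n : ℕ} {P : (Fin N → ℕ) → (Fin N → ℝ) → ℝ} (hP : Fam n P) (i : Fin N)
    (I : Fin N → ℕ) : P I = D1 n i P I + pd i (D1 n i P (I + Pi.single i 1)) := by
  set g : ℕ → (Fin N → ℝ) → ℝ := fun α => (-1 : ℝ) ^ α • (pd i)^[α] (P (I + α • Pi.single i 1))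
    with hg
  have h1 : D1 n i P I = ∑ α ∈ Finset.range (n + 1), g α := rfl
  have h2 : pd i (D1 n i P (I + Pi.single i 1)) = - ∑ α ∈ Finset.range (n + 1), g (α + 1) := by
    unfold D1
    rw [pd_sum (fun α => ((hP.sm _).pd_iter i α).smul _), ← Finset.sum_neg_distrib]
    apply Finset.sum_congr rfl
    intro α _
    rw [pd_smul ((hP.sm _).pd_iter i α), ← Function.iterate_succ_apply' (pd i), hg]
    simp only
    rw [show I + Pi.single i 1 + α • Pi.single i 1 = I + (α + 1) • Pi.single i 1 by
      rw [add_smul, one_smul]; abel]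
    rw [pow_succ]
    simp
  have h3 := Finset.sum_range_succ' g (n + 1)
  have h4 := Finset.sum_range_succ g (n + 1)
  have h5 : g (n + 1) = 0 := by
    simp only [hg]
    rw [hP.van, pd_iter_zero, smul_zero]
    rw [order_add_smul]; omega
  have h6 : g 0 = P I := by simp [hg]
  rw [h1, h2, ← h6]
  rw [h5] at h4
  rw [h3] at h4
  linear_combination h4

theorem D1_comm {N n : ℕ} {P : (Fin N → ℕ) → (Fin N → ℝ) → ℝ} (hP : Fam n P) (i j : Fin N)
    (I : Fin N → ℕ) : D1 n i (D1 n j P) I = D1 n j (D1 n i P) I := by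
  have key : ∀ i j : Fin N, D1 n i (D1 n j P) I = ∑ α ∈ Finset.range (n + 1),
      ∑ β ∈ Finset.range (n + 1), (-1 : ℝ) ^ (α + β) •
        (pd i)^[α] ((pd j)^[β] (P (I + α • Pi.single i 1 + β • Pi.single j 1))) := by
    intro i j
    unfold D1
    apply Finset.sum_congr rfl
    intro α _
    rw [pd_iter_sum (fun β => ((hP.sm _).pd_iter j β).smul _), Finset.smul_sum]
    apply Finset.sum_congr rfl
    intro β _
    rw [pd_iter_smul ((hP.sm _).pd_iter j β), smul_smul, pow_add]
  rw [key, key, Finset.sum_comm]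
  apply Finset.sum_congr rfl
  intro α _
  apply Finset.sum_congr rfl
  intro β _
  rw [pd_iter_comm (hP.sm _), add_comm β α, add_right_comm]

theorem varDer2_eq {N n : ℕ} {L : JetSpace N n → ℝ} (hL : ContDiff ℝ (⊤ : ℕ∞) L)
    {w : (Fin N → ℝ) → ℝ} (hw : Sm w) (i j : Fin N) (I : Fin N → ℕ) :
    varDer2 i j L I w = D1 n i (D1 n j (fun J => pjet L J w)) I := by
  have hP := Fam.pjet hL hw
  set P : (Fin N → ℕ) → (Fin N → ℝ) → ℝ := fun J => pjet L J w with hPdef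
  unfold varDer2 D1
  have hin : ∀ α : ℕ, (∑ᶠ β : ℕ, (-1 : ℝ) ^ (α + β) •
      (pd i)^[α] ((pd j)^[β] (P (I + α • Pi.single i 1 + β • Pi.single j 1))))
      = (-1 : ℝ) ^ α • (pd i)^[α] (∑ β ∈ Finset.range (n + 1),
        (-1 : ℝ) ^ β • (pd j)^[β] (P (I + α • Pi.single i 1 + β • Pi.single j 1))) := by
    intro α
    rw [finsum_eq_sum_of_support_subset (s := Finset.range (n + 1))]
    · rw [pd_iter_sum (fun β => ((hP.sm _).pd_iter j β).smul _), Finset.smul_sum]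
      apply Finset.sum_congr rfl
      intro β _
      rw [pd_iter_smul ((hP.sm _).pd_iter j β), smul_smul, pow_add]
    · intro β hβ
      by_contra hcon
      apply hβ
      simp only [Finset.coe_range, Set.mem_Iio] at hcon
      simp only
      rw [hP.van, pd_iter_zero, pd_iter_zero, smul_zero]
      rw [order_add_smul]; omega
  rw [finsum_congr hin, finsum_eq_sum_of_support_subset (s := Finset.range (n + 1))]
  intro α hα
  by_contra hcon
  apply hα
  simp only [Finset.coe_range, Set.mem_Iio] at hcon
  simp only
  rw [Finset.sum_eq_zero, pd_iter_zero, smul_zero]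
  intro β _
  rw [hP.van, pd_iter_zero, smul_zero]
  rw [order_add_smul, order_add_smul]; omega

theorem Fam.varDer2 {N n : ℕ} {L : JetSpace N n → ℝ} (hL : ContDiff ℝ (⊤ : ℕ∞) L)
    {w : (Fin N → ℝ) → ℝ} (hw : Sm w) (i j : Fin N) : Fam n (fun I => varDer2 i j L I w) := by
  have : (fun I => _root_.varDer2 i j L I w) = _root_.D1 n i (_root_.D1 n j (fun J => _root_.pjet L J w)) :=
    funext fun I => varDer2_eq hL hw i j I
  rw [this]
  exact ((Fam.pjet hL hw).D1 j).D1 i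

theorem varDer2_anti {N n : ℕ} {L L' : JetSpace N n → ℝ} (hL : ContDiff ℝ (⊤ : ℕ∞) L)
    (hLL : L' = -L)
    {w : (Fin N → ℝ) → ℝ} (hw : Sm w) (i j : Fin N) (I : Fin N → ℕ) :
    varDer2 j i L' I w = - varDer2 i j L I w := by
  have hL' : ContDiff ℝ (⊤ : ℕ∞) L' := hLL ▸ hL.neg
  have hP := Fam.pjet hL hw
  have hneg : (fun J => pjet L' J w) = fun J => (-1 : ℝ) • pjet L J w := by
    funext J t
    simp only [pjet, Pi.smul_apply]
    split_ifs
    · rw [hLL, fderiv_neg]; simp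
    · simp
  have hD : ∀ (m : Fin N) (Q : (Fin N → ℕ) → (Fin N → ℝ) → ℝ), Fam n Q →
      D1 n m (fun J => (-1 : ℝ) • Q J) = fun J => (-1 : ℝ) • D1 n m Q J := by
    intro m Q hQ
    funext J
    unfold D1
    rw [Finset.smul_sum]
    apply Finset.sum_congr rfl
    intro α _
    rw [pd_iter_smul (hQ.sm _), smul_comm]
  rw [varDer2_eq hL' hw, varDer2_eq hL hw, hneg, hD i _ hP, hD j _ (hP.D1 i), D1_comm hP i j]
  simp

theorem sum_reindex {N n : ℕ} {M : Type*} [AddCommMonoid M] (g : (Fin N → ℕ) → M)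
    (hg : ∀ I, n < ∑ m, I m → g I = 0) (i : Fin N) :
    ∑ I ∈ boxB N n, g I = ∑ I ∈ boxB N n, (if I i = 0 then g I else 0)
      + ∑ I ∈ boxB N n, g (I + Pi.single i 1) := by
  have h1 : ∑ I ∈ boxB N n, g I = ∑ I ∈ boxB N n, (if I i = 0 then g I else 0)
      + ∑ I ∈ boxB N n, (if I i = 0 then 0 else g I) := by
    rw [← Finset.sum_add_distrib]
    apply Finset.sum_congr rfl
    intro I _
    split_ifs <;> simp
  rw [h1]
  congr 1
  symm
  apply Finset.sum_bij_ne_zero (fun I _ _ => I + Pi.single i 1)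
  · intro I _ h
    rw [mem_boxB]
    by_contra hcon
    exact h (hg _ (by omega))
  · intro I _ _ J _ _ h
    exact add_right_cancel h
  · intro J hJ h
    have hJi : J i ≠ 0 := fun h0 => h (by simp [h0])
    have e : J - Pi.single i 1 + Pi.single i 1 = J := by
      funext a
      by_cases h : a = i
      · subst h; simp; omega
      · simp [Pi.single_eq_of_ne h]
    refine ⟨J - Pi.single i 1, ?_, ?_, e⟩
    · rw [mem_boxB] at hJ ⊢
      have := order_add (J - Pi.single i 1) i
      rw [e] at this
      omega
    · rw [e]; simpa [hJi] using h
  · intro I _ _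
    simp

/-- The pairing of a family of coefficients with the jet of a field. -/
def pairS {N : ℕ} (n : ℕ) (P : (Fin N → ℕ) → (Fin N → ℝ) → ℝ) (φ : (Fin N → ℝ) → ℝ) :
    (Fin N → ℝ) → ℝ := ∑ I ∈ boxB N n, P I * pdMulti I φ

theorem Sm.pairS {N n : ℕ} {P : (Fin N → ℕ) → (Fin N → ℝ) → ℝ} (hP : Fam n P)
    {φ : (Fin N → ℝ) → ℝ} (hφ : Sm φ) : Sm (pairS n P φ) :=
  Sm.sum fun I => (hP.sm I).mul (hφ.pdMulti I)

theorem pairS_zero {N n : ℕ} {P : (Fin N → ℕ) → (Fin N → ℝ) → ℝ}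
    {φ : (Fin N → ℝ) → ℝ} {q : Fin N → ℝ} (h : ∀ I, P I q * pdMulti I φ q = 0) :
    pairS n P φ q = 0 := by
  simp [pairS, h]

theorem pairS_step {N n : ℕ} {P F : (Fin N → ℕ) → (Fin N → ℝ) → ℝ} (hF : Fam n F)
    {φ : (Fin N → ℝ) → ℝ} (hφ : Sm φ) (i : Fin N)
    (h : ∀ I, P I = F I + pd i (F (I + Pi.single i 1))) :
    pairS n P φ = pairS n (fun I => if I i = 0 then F I else 0) φ
      + pd i (pairS n (fun I => F (I + Pi.single i 1)) φ) := by
  have h1 : pd i (pairS n (fun I => F (I + Pi.single i 1)) φ)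
      = ∑ I ∈ boxB N n, (pd i (F (I + Pi.single i 1)) * pdMulti I φ)
      + ∑ I ∈ boxB N n, (F (I + Pi.single i 1) * pdMulti (I + Pi.single i 1) φ) := by
    change pd i (∑ I ∈ boxB N n, F (I + Pi.single i 1) * pdMulti I φ) = _
    have e := pd_sum (s := boxB N n) (f := fun I => F (I + Pi.single i 1 : Fin N → ℕ) * pdMulti I φ)
      (fun I => (hF.sm _).mul (hφ.pdMulti I)) i
    rw [e, ← Finset.sum_add_distrib]
    apply Finset.sum_congr rfl
    intro I _
    rw [pdMulti_succ I i hφ]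
    exact pd_mul (hF.sm _) (hφ.pdMulti I) i
  have h2 := sum_reindex (n := n) (fun I => F I * pdMulti I φ)
    (fun I hI => by rw [hF.van I hI, zero_mul]) i
  have h3 : pairS n P φ = ∑ I ∈ boxB N n, F I * pdMulti I φ
      + ∑ I ∈ boxB N n, (pd i (F (I + Pi.single i 1)) * pdMulti I φ) := by
    unfold pairS
    rw [← Finset.sum_add_distrib]
    apply Finset.sum_congr rfl
    intro I _
    rw [h I, add_mul]
  have h4 : pairS n (fun I => if I i = 0 then F I else 0) φ
      = ∑ I ∈ boxB N n, (if I i = 0 then F I * pdMulti I φ else 0) := by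
    unfold pairS
    apply Finset.sum_congr rfl
    intro I _
    by_cases h0 : I i = 0 <;> simp [h0]
  rw [h3, h2, h4, h1]
  abel

/-- The pointwise first-variation identity on one petal. -/
theorem pairS_main {N n : ℕ} {L : JetSpace N n → ℝ} (hL : ContDiff ℝ (⊤ : ℕ∞) L)
    {w : (Fin N → ℝ) → ℝ} (hw : Sm w) {i j : Fin N} (hij : i ≠ j)
    {φ : (Fin N → ℝ) → ℝ} (hφ : Sm φ) :
    pairS n (fun I => pjet L I w) φ =
      pairS n (fun I => if I i = 0 then (if I j = 0 then varDer2 i j L I w else 0) else 0) φ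
      + pd i (pairS n (fun I => if I j = 0 then varDer2 i j L (I + Pi.single i 1) w else 0) φ)
      + pd j (pairS n (fun I => if I i = 0 then varDer2 i j L (I + Pi.single j 1) w else 0) φ
        + pd i (pairS n (fun I => varDer2 i j L (I + Pi.single i 1 + Pi.single j 1) w) φ)) := by
  have hP := Fam.pjet hL hw
  have hF := hP.D1 j
  have hE := Fam.varDer2 hL hw i j
  have hrec : ∀ I, D1 n j (fun J => pjet L J w) I
      = varDer2 i j L I w + pd i (varDer2 i j L (I + Pi.single i 1) w) := by
    intro I
    rw [varDer2_eq hL hw, varDer2_eq hL hw]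
    exact D1_rec hF i I
  rw [pairS_step hF hφ j (D1_rec hP j)]
  rw [pairS_step (P := fun I => if I j = 0 then D1 n j (fun J => pjet L J w) I else 0)
    (hE.ind j) hφ i]
  · have e := pairS_step (P := fun I => D1 n j (fun J => pjet L J w)
        (I + Pi.single j 1 : Fin N → ℕ)) (hE.shift j) hφ i
        (fun I => by rw [hrec, add_right_comm])
    rw [e]
    simp only [Pi.add_apply, Pi.single_eq_of_ne hij.symm, add_zero]
  · intro I
    simp only [Pi.add_apply, Pi.single_eq_of_ne hij.symm, add_zero]
    split_ifs
    · exact hrec I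
    · rw [pd_zero, add_zero]

theorem hasDerivAt_intervalParam {F F' : ℝ → ℝ → ℝ} (hF : Continuous (Function.uncurry F))
    (hF' : Continuous (Function.uncurry F'))
    (h : ∀ ε s, HasDerivAt (fun ε => F ε s) (F' ε s) ε) (a b x : ℝ) :
    HasDerivAt (fun ε => ∫ s in a..b, F ε s) (∫ s in a..b, F' x s) x := by
  obtain ⟨C, hC⟩ := ((isCompact_closedBall x 1).prod (isCompact_uIcc (a := a) (b := b))).exists_bound_of_continuousOn
    hF'.continuousOn
  have hFc : ∀ e, Continuous (F e) := fun e => hF.comp (by fun_prop : Continuous fun s : ℝ => (e, s))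
  have hFc' : ∀ e, Continuous (F' e) := fun e => hF'.comp (by fun_prop : Continuous fun s : ℝ => (e, s))
  refine (intervalIntegral.hasDerivAt_integral_of_dominated_loc_of_deriv_le
    (bound := fun _ => C) (Metric.closedBall_mem_nhds x one_pos) ?_ ?_ ?_ ?_ ?_ ?_).2
  · exact Filter.Eventually.of_forall fun e => (hFc e).aestronglyMeasurable
  · exact (hFc x).intervalIntegrable _ _
  · exact (hFc' x).aestronglyMeasurable
  · refine Filter.Eventually.of_forall fun s hs e he => ?_
    exact hC (e, s) ⟨he, Set.uIoc_subset_uIcc hs⟩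
  · exact intervalIntegrable_const
  · exact Filter.Eventually.of_forall fun s _ e _ => h e s

theorem hasDerivAt_line {N : ℕ} {f : (Fin N → ℝ) → ℝ} (hf : Sm f) (q : Fin N → ℝ) (i : Fin N) (s : ℝ) :
    HasDerivAt (fun s : ℝ => f (q + s • unitVec i)) (pd i f (q + s • unitVec i)) s := by
  have h1 : HasDerivAt (fun s : ℝ => q + s • unitVec i) (unitVec i) s := by
    simpa using ((hasDerivAt_id s).smul_const (unitVec i)).const_add q
  exact (hf.diff _).hasFDerivAt.comp_hasDerivAt s h1

theorem ftc_line {N : ℕ} {f : (Fin N → ℝ) → ℝ} (hf : Sm f) (q : Fin N → ℝ) (i : Fin N) (a : ℝ) :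
    ∫ s in (0 : ℝ)..a, pd i f (q + s • unitVec i) = f (q + a • unitVec i) - f q := by
  rw [intervalIntegral.integral_eq_sub_of_hasDerivAt (fun s _ => hasDerivAt_line hf q i s)]
  · simp
  · apply Continuous.intervalIntegrable
    exact (hf.pd i).continuous.comp (by fun_prop)

theorem petal_hasDerivAt {N n : ℕ} (L : Fin N → Fin N → JetSpace N n → ℝ)
    (hLs : ∀ i j, ContDiff ℝ (⊤ : ℕ∞) (L i j)) {u φ : (Fin N → ℝ) → ℝ} (hu : Sm u) (hφ : Sm φ)
    (p : Fin N → ℝ) (i j : Fin N) (ai aj : ℝ) :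
    HasDerivAt (fun ε : ℝ => petalAction L (u + ε • φ) p i j ai aj)
      (∫ s in (0:ℝ)..ai, ∫ t in (0:ℝ)..aj,
        pairS n (fun I => pjet (L i j) I u) φ (p + s • unitVec i + t • unitVec j)) 0 := by
  have hju := (hu.jet n).continuous
  have hjφ := (hφ.jet n).continuous
  have hLc := (hLs i j).continuous
  have hLd : Continuous (fderiv ℝ (L i j)) := (hLs i j).continuous_fderiv (by simp)
  set q : ℝ → ℝ → Fin N → ℝ := fun s t => p + s • unitVec i + t • unitVec j with hq
  have hqc : Continuous (fun x : ℝ × ℝ => q x.1 x.2) := by simp only [hq]; fun_prop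
  set G : ℝ → ℝ → ℝ → ℝ := fun ε s t => L i j (jet n u (q s t) + ε • jet n φ (q s t)) with hG
  set G' : ℝ → ℝ → ℝ → ℝ := fun ε s t =>
    fderiv ℝ (L i j) (jet n u (q s t) + ε • jet n φ (q s t)) (jet n φ (q s t)) with hG'
  have hargc : Continuous (fun x : (ℝ × ℝ) × ℝ =>
      jet n u (q x.1.2 x.2) + x.1.1 • jet n φ (q x.1.2 x.2)) := by
    have h1 : Continuous (fun x : (ℝ × ℝ) × ℝ => q x.1.2 x.2) :=
      hqc.comp (by fun_prop : Continuous fun x : (ℝ × ℝ) × ℝ => (x.1.2, x.2))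
    exact (hju.comp h1).add (continuous_fst.fst.smul (hjφ.comp h1))
  have hGc : Continuous (fun x : (ℝ × ℝ) × ℝ => G x.1.1 x.1.2 x.2) := hLc.comp hargc
  have hGc' : Continuous (fun x : (ℝ × ℝ) × ℝ => G' x.1.1 x.1.2 x.2) := by
    have h1 : Continuous (fun x : (ℝ × ℝ) × ℝ => q x.1.2 x.2) :=
      hqc.comp (by fun_prop : Continuous fun x : (ℝ × ℝ) × ℝ => (x.1.2, x.2))
    exact (hLd.comp hargc).clm_apply (hjφ.comp h1)
  have hder : ∀ s t ε, HasDerivAt (fun ε => G ε s t) (G' ε s t) ε := by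
    intro s t ε
    have h1 : HasDerivAt (fun ε : ℝ => jet n u (q s t) + ε • jet n φ (q s t)) (jet n φ (q s t)) ε := by
      simpa using ((hasDerivAt_id ε).smul_const (jet n φ (q s t))).const_add (jet n u (q s t))
    exact ((hLs i j).differentiable (by simp) _).hasFDerivAt.comp_hasDerivAt ε h1
  have hin : ∀ ε s, HasDerivAt (fun ε => ∫ t in (0:ℝ)..aj, G ε s t) (∫ t in (0:ℝ)..aj, G' ε s t) ε := by
    intro ε s
    refine hasDerivAt_intervalParam (F := fun ε t => G ε s t) (F' := fun ε t => G' ε s t)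
      ?_ ?_ (fun ε t => hder s t ε) 0 aj ε
    · exact hGc.comp (by fun_prop : Continuous fun x : ℝ × ℝ => ((x.1, s), x.2))
    · exact hGc'.comp (by fun_prop : Continuous fun x : ℝ × ℝ => ((x.1, s), x.2))
  have hout := hasDerivAt_intervalParam (F := fun ε s => ∫ t in (0:ℝ)..aj, G ε s t)
    (F' := fun ε s => ∫ t in (0:ℝ)..aj, G' ε s t)
    (intervalIntegral.continuous_parametric_intervalIntegral_of_continuous'
      (f := fun (x : ℝ × ℝ) t => G x.1 x.2 t) hGc 0 aj)
    (intervalIntegral.continuous_parametric_intervalIntegral_of_continuous'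
      (f := fun (x : ℝ × ℝ) t => G' x.1 x.2 t) hGc' 0 aj) hin 0 ai 0
  have e1 : (fun ε : ℝ => petalAction L (u + ε • φ) p i j ai aj)
      = fun ε => ∫ s in (0:ℝ)..ai, ∫ t in (0:ℝ)..aj, G ε s t := by
    funext ε
    unfold petalAction jev
    simp only [jet_add_smul hu hφ, hG, hq]
  have e2 : ∀ s t, pairS n (fun I => pjet (L i j) I u) φ (p + s • unitVec i + t • unitVec j)
      = G' 0 s t := by
    intro s t
    change pairS n (fun I => pjet (L i j) I u) φ (q s t) = _
    simp only [hG', zero_smul, add_zero]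
    generalize q s t = y
    rw [← ContinuousLinearMap.coe_coe, LinearMap.pi_apply_eq_sum_univ]
    unfold pairS boxB
    rw [Finset.sum_map, Finset.sum_apply]
    apply Finset.sum_congr rfl
    intro I _
    simp only [Function.Embedding.coeFn_mk, Pi.mul_apply, smul_eq_mul]
    rw [mul_comm]
    congr 1
    simp only [pjet, I.2, dif_pos]
    rw [ContinuousLinearMap.coe_coe]
    congr 1
    funext J
    simp [Pi.single_apply, eq_comm]
  rw [e1]
  simp only [e2]
  exact hout

theorem petal_formula {N n : ℕ} {L : JetSpace N n → ℝ} (hL : ContDiff ℝ (⊤ : ℕ∞) L)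
    {u φ : (Fin N → ℝ) → ℝ} (hu : Sm u) (hφ : Sm φ)
    (p : Fin N → ℝ) {i j : Fin N} (hij : i ≠ j) {ai aj : ℝ} (hai : 0 < ai) (haj : 0 < aj)
    (hd : ∀ I, ∀ q ∈ petalOuter p i j ai aj, pdMulti I φ q = 0) :
    (∫ s in (0:ℝ)..ai, ∫ t in (0:ℝ)..aj,
        pairS n (fun I => pjet L I u) φ (p + s • unitVec i + t • unitVec j))
    = (∫ s in (0:ℝ)..ai, ∫ t in (0:ℝ)..aj,
        pairS n (fun I => if I i = 0 then (if I j = 0 then varDer2 i j L I u else 0) else 0) φ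
          (p + s • unitVec i + t • unitVec j))
      - (∫ t in (0:ℝ)..aj, pairS n (fun I => if I j = 0 then varDer2 i j L (I + Pi.single i 1) u else 0) φ
          (p + t • unitVec j))
      - (∫ s in (0:ℝ)..ai, pairS n (fun I => if I i = 0 then varDer2 i j L (I + Pi.single j 1) u else 0) φ
          (p + s • unitVec i))
      + pairS n (fun I => varDer2 i j L (I + Pi.single i 1 + Pi.single j 1) u) φ p := by
  have hE := Fam.varDer2 hL hu i j
  have hZ := Sm.pairS ((hE.ind j).ind i) hφ
  have hX := Sm.pairS ((hE.shift i).ind j) hφ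
  have hY := Sm.pairS ((hE.shift j).ind i) hφ
  have hW := Sm.pairS ((hE.shift j).shift i) hφ
  have hp : ∀ (P : (Fin N → ℕ) → (Fin N → ℝ) → ℝ), ∀ q ∈ petalOuter p i j ai aj, pairS n P φ q = 0 :=
    fun P q hq => pairS_zero fun I => by rw [hd I q hq, mul_zero]
  rw [pairS_main hL hu hij hφ]
  have hXz := hp (fun I => if I j = 0 then varDer2 i j L (I + Pi.single i 1) u else 0)
  have hYz := hp (fun I => if I i = 0 then varDer2 i j L (I + Pi.single j 1) u else 0)
  have hWz := hp (fun I => varDer2 i j L (I + Pi.single i 1 + Pi.single j 1) u)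
  set Z := pairS n (fun I => if I i = 0 then (if I j = 0 then varDer2 i j L I u else 0) else 0) φ
  set X := pairS n (fun I => if I j = 0 then varDer2 i j L (I + Pi.single i 1) u else 0) φ
  set Y := pairS n (fun I => if I i = 0 then varDer2 i j L (I + Pi.single j 1) u else 0) φ
  set W := pairS n (fun I => varDer2 i j L (I + Pi.single i 1 + Pi.single j 1) u) φ
  have hYW : Sm (Y + pd i W) := ContDiff.add hY (Sm.pd hW i)
  have c2 : ∀ {f : (Fin N → ℝ) → ℝ}, Sm f → Continuous (fun x : ℝ × ℝ =>
      f (p + x.1 • unitVec i + x.2 • unitVec j)) := fun hf => hf.continuous.comp (by fun_prop)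
  have c1 : ∀ {f : (Fin N → ℝ) → ℝ}, Sm f → ∀ s : ℝ, Continuous (fun t : ℝ =>
      f (p + s • unitVec i + t • unitVec j)) := fun hf s => hf.continuous.comp (by fun_prop)
  have c0 : ∀ {f : (Fin N → ℝ) → ℝ}, Sm f → ∀ (q : Fin N → ℝ) m, Continuous (fun t : ℝ =>
      f (q + t • unitVec m)) := fun hf s m => hf.continuous.comp (by fun_prop)
  have c3 : ∀ {f : (Fin N → ℝ) → ℝ}, Sm f → Continuous (fun s : ℝ => ∫ t in (0:ℝ)..aj,
      f (p + s • unitVec i + t • unitVec j)) := fun hf =>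
    intervalIntegral.continuous_parametric_intervalIntegral_of_continuous' (c2 hf) 0 aj
  have split : (∫ s in (0:ℝ)..ai, ∫ t in (0:ℝ)..aj,
        (Z + pd i X + pd j (Y + pd i W)) (p + s • unitVec i + t • unitVec j))
      = (∫ s in (0:ℝ)..ai, ∫ t in (0:ℝ)..aj, Z (p + s • unitVec i + t • unitVec j))
      + (∫ s in (0:ℝ)..ai, ∫ t in (0:ℝ)..aj, pd i X (p + s • unitVec i + t • unitVec j))
      + (∫ s in (0:ℝ)..ai, ∫ t in (0:ℝ)..aj, pd j (Y + pd i W) (p + s • unitVec i + t • unitVec j)) := by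
    rw [← intervalIntegral.integral_add, ← intervalIntegral.integral_add]
    · apply intervalIntegral.integral_congr
      intro s _
      simp only
      rw [← intervalIntegral.integral_add, ← intervalIntegral.integral_add]
      · rfl
      · exact ((c1 hZ s).add (c1 (hX.pd i) s)).intervalIntegrable _ _
      · exact (c1 (hYW.pd j) s).intervalIntegrable _ _
      · exact (c1 hZ s).intervalIntegrable _ _
      · exact (c1 (hX.pd i) s).intervalIntegrable _ _
    · exact ((c3 hZ).add (c3 (hX.pd i))).intervalIntegrable _ _
    · exact (c3 (hYW.pd j)).intervalIntegrable _ _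
    · exact (c3 hZ).intervalIntegrable _ _
    · exact (c3 (hX.pd i)).intervalIntegrable _ _
  rw [split]
  have o1 : ∀ t ∈ Set.uIcc 0 aj, p + ai • unitVec i + t • unitVec j ∈ petalOuter p i j ai aj := by
    intro t ht
    rw [Set.uIcc_of_le haj.le] at ht
    exact Or.inl ⟨t, ht, rfl⟩
  have o2 : ∀ s ∈ Set.uIcc 0 ai, p + s • unitVec i + aj • unitVec j ∈ petalOuter p i j ai aj := by
    intro s hs
    rw [Set.uIcc_of_le hai.le] at hs
    exact Or.inr ⟨s, hs, by simp only; abel⟩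
  have tX : (∫ s in (0:ℝ)..ai, ∫ t in (0:ℝ)..aj, pd i X (p + s • unitVec i + t • unitVec j))
      = - ∫ t in (0:ℝ)..aj, X (p + t • unitVec j) := by
    rw [MeasureTheory.intervalIntegral_intervalIntegral_swap]
    · rw [← intervalIntegral.integral_neg]
      apply intervalIntegral.integral_congr
      intro t ht
      simp only
      have := ftc_line hX (p + t • unitVec j) i ai
      rw [add_right_comm, hXz _ (o1 t ht), zero_sub] at this
      rw [← this]
      apply intervalIntegral.integral_congr
      intro s _
      simp only
      rw [add_right_comm]
    · apply MeasureTheory.IntegrableOn.mono_set (t := Set.uIcc 0 ai ×ˢ Set.uIcc 0 aj)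
      · exact (c2 (hX.pd i)).continuousOn.integrableOn_compact (isCompact_uIcc.prod isCompact_uIcc)
      · exact Set.prod_mono Set.uIoc_subset_uIcc Set.uIoc_subset_uIcc
  have tY : (∫ s in (0:ℝ)..ai, ∫ t in (0:ℝ)..aj, pd j (Y + pd i W) (p + s • unitVec i + t • unitVec j))
      = W p - ∫ s in (0:ℝ)..ai, Y (p + s • unitVec i) := by
    have e1 : ∀ s : ℝ, s ∈ Set.uIcc 0 ai →
        (∫ t in (0:ℝ)..aj, pd j (Y + pd i W) (p + s • unitVec i + t • unitVec j))
        = pd i W (p + aj • unitVec j + s • unitVec i)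
          - Y (p + s • unitVec i) - pd i W (p + s • unitVec i) := by
      intro s hs
      rw [ftc_line hYW]
      simp only [Pi.add_apply]
      rw [hYz _ (o2 s hs), add_right_comm p (aj • unitVec j)]
      ring
    rw [intervalIntegral.integral_congr e1, intervalIntegral.integral_sub,
      intervalIntegral.integral_sub, ftc_line hW, ftc_line hW]
    · have z1 := hWz _ (o1 aj Set.right_mem_uIcc)
      have z2 := hWz _ (o2 0 Set.left_mem_uIcc)
      have z3 := hWz _ (o1 0 Set.left_mem_uIcc)
      rw [add_right_comm] at z1
      rw [zero_smul, add_zero] at z2 z3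
      rw [z1, z2, z3]
      ring
    · exact (c0 (hW.pd i) _ _).intervalIntegrable _ _
    · exact (c0 hY _ _).intervalIntegrable _ _
    · exact ((c0 (hW.pd i) _ _).sub (c0 hY _ _)).intervalIntegrable _ _
    · exact (c0 (hW.pd i) _ _).intervalIntegrable _ _
  rw [tX, tY]
  ring

/-- The area coefficient family. -/
def famZ {N n : ℕ} (L : Fin N → Fin N → JetSpace N n → ℝ) (u : (Fin N → ℝ) → ℝ) (i j : Fin N) :
    (Fin N → ℕ) → (Fin N → ℝ) → ℝ :=
  fun I => if I i = 0 then (if I j = 0 then varDer2 i j (L i j) I u else 0) else 0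

/-- The coefficient family on the edge in direction `j`. -/
def famX {N n : ℕ} (L : Fin N → Fin N → JetSpace N n → ℝ) (u : (Fin N → ℝ) → ℝ) (i j : Fin N) :
    (Fin N → ℕ) → (Fin N → ℝ) → ℝ :=
  fun I => if I j = 0 then varDer2 i j (L i j) (I + Pi.single i 1) u else 0

/-- The coefficient family on the edge in direction `i`. -/
def famY {N n : ℕ} (L : Fin N → Fin N → JetSpace N n → ℝ) (u : (Fin N → ℝ) → ℝ) (i j : Fin N) :
    (Fin N → ℕ) → (Fin N → ℝ) → ℝ :=
  fun I => if I i = 0 then varDer2 i j (L i j) (I + Pi.single j 1) u else 0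

/-- The coefficient family at the center. -/
def famW {N n : ℕ} (L : Fin N → Fin N → JetSpace N n → ℝ) (u : (Fin N → ℝ) → ℝ) (i j : Fin N) :
    (Fin N → ℕ) → (Fin N → ℝ) → ℝ :=
  fun I => varDer2 i j (L i j) (I + Pi.single i 1 + Pi.single j 1) u

/-- The first variation on one petal. -/
def petalVar {N n : ℕ} (L : Fin N → Fin N → JetSpace N n → ℝ) (u φ : (Fin N → ℝ) → ℝ)
    (p : Fin N → ℝ) (i j : Fin N) (ai aj : ℝ) : ℝ :=
  (∫ s in (0:ℝ)..ai, ∫ t in (0:ℝ)..aj, pairS n (famZ L u i j) φ (p + s • unitVec i + t • unitVec j))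
    - (∫ t in (0:ℝ)..aj, pairS n (famX L u i j) φ (p + t • unitVec j))
    - (∫ s in (0:ℝ)..ai, pairS n (famY L u i j) φ (p + s • unitVec i))
    + pairS n (famW L u i j) φ p

section fams
variable {N n : ℕ} {L : Fin N → Fin N → JetSpace N n → ℝ}
  (hL : ∀ i j, ContDiff ℝ (⊤ : ℕ∞) (L i j)) {u : (Fin N → ℝ) → ℝ} (hu : Sm u) (i j : Fin N)

theorem famZ_fam (hL : ∀ i j, ContDiff ℝ (⊤ : ℕ∞) (L i j)) (hu : Sm u) : Fam n (famZ L u i j) :=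
  ((Fam.varDer2 (hL i j) hu i j).ind j).ind i

theorem famX_fam (hL : ∀ i j, ContDiff ℝ (⊤ : ℕ∞) (L i j)) (hu : Sm u) : Fam n (famX L u i j) :=
  ((Fam.varDer2 (hL i j) hu i j).shift i).ind j

theorem famY_fam (hL : ∀ i j, ContDiff ℝ (⊤ : ℕ∞) (L i j)) (hu : Sm u) : Fam n (famY L u i j) :=
  ((Fam.varDer2 (hL i j) hu i j).shift j).ind i

theorem famW_fam (hL : ∀ i j, ContDiff ℝ (⊤ : ℕ∞) (L i j)) (hu : Sm u) : Fam n (famW L u i j) :=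
  ((Fam.varDer2 (hL i j) hu i j).shift j).shift i

end fams

theorem petal_hasDerivAt' {N n : ℕ} {L : Fin N → Fin N → JetSpace N n → ℝ}
    (hL : ∀ i j, ContDiff ℝ (⊤ : ℕ∞) (L i j)) {u φ : (Fin N → ℝ) → ℝ} (hu : Sm u) (hφ : Sm φ)
    (p : Fin N → ℝ) {i j : Fin N} (hij : i ≠ j) {ai aj : ℝ} (hai : 0 < ai) (haj : 0 < aj)
    (hd : ∀ q ∈ petalOuter p i j ai aj, q ∉ tsupport φ) :
    HasDerivAt (fun ε : ℝ => petalAction L (u + ε • φ) p i j ai aj)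
      (petalVar L u φ p i j ai aj) 0 := by
  have h := petal_hasDerivAt L hL hu hφ p i j ai aj
  rw [petal_formula (hL i j) hu hφ p hij hai haj
    (fun I q hq => pdMulti_eq_zero hφ I (hd q hq))] at h
  exact h

theorem flower_deriv {N n : ℕ} {L : Fin N → Fin N → JetSpace N n → ℝ}
    (hL : ∀ i j, ContDiff ℝ (⊤ : ℕ∞) (L i j)) {u φ : (Fin N → ℝ) → ℝ} (hu : Sm u) (hφ : Sm φ)
    (p : Fin N → ℝ) {i j k : Fin N} (hij : i ≠ j) (hjk : j ≠ k) (hik : i ≠ k)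
    {ai aj ak : ℝ} (hai : 0 < ai) (haj : 0 < aj) (hak : 0 < ak)
    (hd : Disjoint (tsupport φ)
          (petalOuter p i j ai aj ∪ petalOuter p j k aj ak ∪ petalOuter p k i ak ai)) :
    deriv (fun ε : ℝ =>
          petalAction L (u + ε • φ) p i j ai aj
          + petalAction L (u + ε • φ) p j k aj ak
          + petalAction L (u + ε • φ) p k i ak ai) 0
      = petalVar L u φ p i j ai aj + petalVar L u φ p j k aj ak + petalVar L u φ p k i ak ai := by
  rw [Set.disjoint_right] at hd
  have h1 := petal_hasDerivAt' hL hu hφ p hij hai haj (fun q hq => hd (Or.inl (Or.inl hq)))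
  have h2 := petal_hasDerivAt' hL hu hφ p hjk haj hak (fun q hq => hd (Or.inl (Or.inr hq)))
  have h3 := petal_hasDerivAt' hL hu hφ p hik.symm hak hai (fun q hq => hd (Or.inr hq))
  exact ((h1.add h2).add h3).deriv

theorem pairS_add_zero {N n : ℕ} {P Q : (Fin N → ℕ) → (Fin N → ℝ) → ℝ}
    {φ : (Fin N → ℝ) → ℝ} {q : Fin N → ℝ} (h : ∀ I, P I q + Q I q = 0) :
    pairS n P φ q = - pairS n Q φ q := by
  unfold pairS
  rw [Finset.sum_apply, Finset.sum_apply, ← Finset.sum_neg_distrib]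
  apply Finset.sum_congr rfl
  intro I _
  simp only [Pi.mul_apply]
  linear_combination (pdMulti I φ q) * h I

theorem pairS_single {N n : ℕ} {P : (Fin N → ℕ) → (Fin N → ℝ) → ℝ} (hP : Fam n P)
    {φ : (Fin N → ℝ) → ℝ} {q : Fin N → ℝ} (K : Fin N → ℕ)
    (h : ∀ I, I ≠ K → P I q * pdMulti I φ q = 0) :
    pairS n P φ q = P K q * pdMulti K φ q := by
  unfold pairS
  rw [Finset.sum_apply, Finset.sum_eq_single K]
  · rfl
  · intro I _ hI
    exact h I hI
  · intro hK
    rw [mem_boxB, not_le] at hK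
    rw [hP.van K hK]
    simp

theorem flower_of_EL12 {N n : ℕ} {L : Fin N → Fin N → JetSpace N n → ℝ}
    {u φ : (Fin N → ℝ) → ℝ}
    (h1 : ∀ i j : Fin N, i ≠ j → ∀ I t, famZ L u i j I t = 0)
    (h2 : ∀ i j k : Fin N, i ≠ j → j ≠ k → i ≠ k → ∀ I t, famY L u i j I t + famX L u k i I t = 0)
    (p : Fin N → ℝ) {i j k : Fin N} (hij : i ≠ j) (hjk : j ≠ k) (hik : i ≠ k) (ai aj ak : ℝ) :
    petalVar L u φ p i j ai aj + petalVar L u φ p j k aj ak + petalVar L u φ p k i ak ai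
      = pairS n (famW L u i j) φ p + pairS n (famW L u j k) φ p + pairS n (famW L u k i) φ p := by
  have hz : ∀ i j : Fin N, i ≠ j → ∀ q, pairS n (famZ L u i j) φ q = 0 := fun i j h q =>
    pairS_zero fun I => by rw [h1 i j h, zero_mul]
  have hy : ∀ i j k : Fin N, i ≠ j → j ≠ k → i ≠ k → ∀ q,
      pairS n (famY L u i j) φ q = - pairS n (famX L u k i) φ q := fun i j k a b c q =>
    pairS_add_zero fun I => h2 i j k a b c I q
  unfold petalVar
  simp only [hz i j hij, hz j k hjk, hz k i hik.symm, hy i j k hij hjk hik,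
    hy j k i hjk hik.symm hij.symm, hy k i j hik.symm hij hjk.symm,
    intervalIntegral.integral_neg, intervalIntegral.integral_zero]
  ring

/-! ### Test functions -/

/-- One-dimensional test functions supported in a given set. -/
structure Test (S : Set ℝ) (f : ℝ → ℝ) : Prop where
  sm : ContDiff ℝ (⊤ : ℕ∞) f
  cpt : HasCompactSupport f
  sub : tsupport f ⊆ S

theorem deriv_iter_sm {f : ℝ → ℝ} (hf : ContDiff ℝ (⊤ : ℕ∞) f) (k : ℕ) :
    ContDiff ℝ (⊤ : ℕ∞) (deriv^[k] f) := by
  induction k with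
  | zero => exact hf
  | succ k ih =>
    rw [Function.iterate_succ_apply']
    exact (contDiff_infty_iff_deriv.1 ih).2

theorem deriv_iter_zero {f : ℝ → ℝ} {x : ℝ} (hx : x ∉ tsupport f) (k : ℕ) :
    deriv^[k] f x = 0 := by
  rw [notMem_tsupport_iff_eventuallyEq] at hx
  rw [← iteratedDeriv_eq_iterate, Filter.EventuallyEq.iteratedDeriv_eq k hx]
  simp

theorem exists_mono (l : ℕ) : ∃ f : ℝ → ℝ, Test (Set.Ioo (-2) 2) f ∧
    ∀ k, deriv^[k] f 0 = if k = l then 1 else 0 := by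
  let χ : ContDiffBump (0 : ℝ) := ⟨1 / 2, 1, by norm_num, by norm_num⟩
  refine ⟨fun x => χ x * (x ^ l / (l.factorial : ℝ)), ⟨?_, ?_, ?_⟩, ?_⟩
  · exact χ.contDiff.mul ((contDiff_id.pow l).div_const _)
  · exact χ.hasCompactSupport.mul_right
  · refine (tsupport_mul_subset_left (f := χ)).trans ?_
    rw [χ.tsupport_eq]
    intro x hx
    rw [Metric.mem_closedBall, Real.dist_eq, sub_zero, abs_le] at hx
    change -1 ≤ x ∧ x ≤ 1 at hx
    constructor <;> linarith [hx.1, hx.2]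
  · intro k
    have he : (fun x => χ x * (x ^ l / (l.factorial : ℝ))) =ᶠ[nhds 0]
        fun x => (l.factorial : ℝ)⁻¹ * x ^ l := by
      filter_upwards [χ.eventuallyEq_one] with x hx
      rw [hx]
      simp only [Pi.one_apply]
      field_simp
    rw [← iteratedDeriv_eq_iterate, he.iteratedDeriv_eq k, iteratedDeriv_const_mul_field,
      iteratedDeriv_fun_pow_zero]
    have hl : (l.factorial : ℝ) ≠ 0 := by exact_mod_cast l.factorial_ne_zero
    split_ifs <;> simp_all

/-- A fixed choice of the localized monomials. -/
def mono (l : ℕ) : ℝ → ℝ := (exists_mono l).choose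

theorem mono_test (l : ℕ) : Test (Set.Ioo (-2) 2) (mono l) := (exists_mono l).choose_spec.1

theorem mono_deriv (l k : ℕ) : deriv^[k] (mono l) 0 = if k = l then 1 else 0 :=
  (exists_mono l).choose_spec.2 k

/-- Products of one-dimensional functions, centered at `p`. -/
def prodFn {N : ℕ} (p : Fin N → ℝ) (f : Fin N → ℝ → ℝ) : (Fin N → ℝ) → ℝ :=
  fun t => ∏ m, f m (t m - p m)

theorem prodFn_sm {N : ℕ} (p : Fin N → ℝ) {f : Fin N → ℝ → ℝ}
    (hf : ∀ m, ContDiff ℝ (⊤ : ℕ∞) (f m)) : Sm (prodFn p f) := by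
  unfold prodFn
  apply contDiff_prod
  intro m _
  exact (hf m).comp ((contDiff_apply ℝ ℝ m).sub contDiff_const)

theorem pd_prodFn {N : ℕ} (p : Fin N → ℝ) {f : Fin N → ℝ → ℝ}
    (hf : ∀ m, ContDiff ℝ (⊤ : ℕ∞) (f m)) (i : Fin N) :
    pd i (prodFn p f) = prodFn p (Function.update f i (deriv (f i))) := by
  funext t
  have h1 : HasDerivAt (fun s : ℝ => prodFn p f (t + s • unitVec i)) (pd i (prodFn p f) t) 0 := by
    simpa using hasDerivAt_line (prodFn_sm p hf) t i 0
  have e : ∀ (g : Fin N → ℝ → ℝ) (y : Fin N → ℝ), prodFn p g y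
      = g i (y i - p i) * ∏ m ∈ Finset.univ.erase i, g m (y m - p m) := fun g y =>
    (Finset.mul_prod_erase _ _ (Finset.mem_univ i)).symm
  have h2 : (fun s : ℝ => prodFn p f (t + s • unitVec i))
      = fun s : ℝ => f i (t i - p i + s) * ∏ m ∈ Finset.univ.erase i, f m (t m - p m) := by
    funext s
    rw [e]
    congr 1
    · simp [unitVec]; congr 1; ring
    · apply Finset.prod_congr rfl
      intro m hm
      simp [unitVec, Pi.single_eq_of_ne (Finset.ne_of_mem_erase hm)]
  have h3 : HasDerivAt (fun s : ℝ => f i (t i - p i + s) * ∏ m ∈ Finset.univ.erase i, f m (t m - p m))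
      (deriv (f i) (t i - p i) * ∏ m ∈ Finset.univ.erase i, f m (t m - p m)) 0 := by
    apply HasDerivAt.mul_const
    have := ((hf i).differentiable (by simp) (t i - p i + 0)).hasDerivAt
    have h4 := HasDerivAt.comp_const_add (t i - p i) 0 this
    simpa using h4
  rw [h2] at h1
  rw [h1.unique h3, e]
  congr 1
  · simp
  · apply Finset.prod_congr rfl
    intro m hm
    rw [Function.update_of_ne (Finset.ne_of_mem_erase hm)]

theorem pdMulti_prodFn {N : ℕ} (p : Fin N → ℝ) {f : Fin N → ℝ → ℝ}
    (hf : ∀ m, ContDiff ℝ (⊤ : ℕ∞) (f m)) (I : Fin N → ℕ) :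
    pdMulti I (prodFn p f) = prodFn p (fun m => deriv^[I m] (f m)) := by
  induction I using multi_induction with
  | h0 => rw [pdMulti_zero]; rfl
  | hs I m ih =>
    rw [pdMulti_succ I m (prodFn_sm p hf), ih, pd_prodFn p (fun a => deriv_iter_sm (hf a) _)]
    congr 1
    funext a
    by_cases h : a = m
    · subst h
      simp only [Function.update_self, Pi.add_apply, Pi.single_eq_same,
        Function.iterate_succ_apply']
    · rw [Function.update_of_ne h]
      simp [Pi.single_eq_of_ne h]

theorem pdMulti_prodFn_zero {N : ℕ} {p : Fin N → ℝ} {f : Fin N → ℝ → ℝ}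
    (hf : ∀ m, ContDiff ℝ (⊤ : ℕ∞) (f m)) (I : Fin N → ℕ) {q : Fin N → ℝ} (m : Fin N)
    (hm : deriv^[I m] (f m) (q m - p m) = 0) : pdMulti I (prodFn p f) q = 0 := by
  rw [pdMulti_prodFn p hf]
  exact Finset.prod_eq_zero (Finset.mem_univ m) hm

theorem tsupport_prodFn {N : ℕ} (p : Fin N → ℝ) (f : Fin N → ℝ → ℝ) :
    tsupport (prodFn p f) ⊆ {t | ∀ m, t m - p m ∈ tsupport (f m)} := by
  apply closure_minimal
  · intro t ht m
    apply subset_tsupport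
    intro h0
    exact ht (Finset.prod_eq_zero (Finset.mem_univ m) h0)
  · rw [Set.ofPred_forall]
    apply isClosed_iInter
    intro m
    exact (isClosed_tsupport (f m)).preimage (by fun_prop : Continuous fun t : Fin N → ℝ => t m - p m)

theorem prodFn_cpt {N : ℕ} (p : Fin N → ℝ) {f : Fin N → ℝ → ℝ}
    (hf : ∀ m, HasCompactSupport (f m)) : HasCompactSupport (prodFn p f) := by
  have hK : IsCompact (Set.pi Set.univ fun m => (fun x => x + p m) '' tsupport (f m)) :=
    isCompact_univ_pi fun m => (hf m).isCompact.image (by fun_prop)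
  refine HasCompactSupport.of_support_subset_isCompact hK ?_
  intro t ht m _
  exact ⟨t m - p m, tsupport_prodFn p f (subset_tsupport _ ht) m, by simp⟩

theorem outer_coord {N : ℕ} {p q : Fin N → ℝ} {i j : Fin N} (hij : i ≠ j) {ai aj : ℝ}
    (hq : q ∈ petalOuter p i j ai aj) : q i - p i = ai ∨ q j - p j = aj := by
  rcases hq with ⟨s, _, rfl⟩ | ⟨s, _, rfl⟩
  · left; simp [unitVec, Pi.single_eq_of_ne hij]
  · right; simp [unitVec, Pi.single_eq_of_ne hij.symm]

theorem prodFn_disjoint {N : ℕ} (p : Fin N → ℝ) {f : Fin N → ℝ → ℝ}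
    (hf : ∀ m, Test (Set.Ioo (-2) 2) (f m)) {i j k : Fin N} (hij : i ≠ j) (hjk : j ≠ k) (hik : i ≠ k) :
    Disjoint (tsupport (prodFn p f))
      (petalOuter p i j 2 2 ∪ petalOuter p j k 2 2 ∪ petalOuter p k i 2 2) := by
  rw [Set.disjoint_left]
  intro q hq hq'
  have hlt : ∀ m, q m - p m ≠ 2 := fun m h => by
    have := ((hf m).sub (tsupport_prodFn p f hq m)).2
    linarith
  rcases hq' with (h | h) | h
  · rcases outer_coord hij h with h | h <;> exact hlt _ h
  · rcases outer_coord hjk h with h | h <;> exact hlt _ h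
  · rcases outer_coord hik.symm h with h | h <;> exact hlt _ h

theorem fund_lemma {h : ℝ → ℝ} (hc : Continuous h)
    (H : ∀ g, Test (Set.Ioo 0 2) g → ∫ s in (0:ℝ)..2, h s * g s = 0) : h 1 = 0 := by
  have hae : ∀ᵐ x ∂(MeasureTheory.volume : MeasureTheory.Measure ℝ), x ∈ Set.Ioo (0:ℝ) 2 → h x = 0 := by
    apply isOpen_Ioo.ae_eq_zero_of_integral_contDiff_smul_eq_zero
      (hc.locallyIntegrable.locallyIntegrableOn _)
    intro g hg hgc hgs
    rw [← H g ⟨hg, hgc, hgs⟩, intervalIntegral.integral_of_le (by norm_num),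
      MeasureTheory.setIntegral_eq_integral_of_forall_compl_eq_zero]
    · simp only [smul_eq_mul, mul_comm]
    · intro x hx
      have hz : g x = 0 :=
        image_eq_zero_of_notMem_tsupport fun hx' => hx (Set.Ioo_subset_Ioc_self (hgs hx'))
      rw [hz, mul_zero]
  have h2 : Set.EqOn h (fun _ => 0) (Set.Ioo 0 2) := by
    refine MeasureTheory.Measure.eqOn_open_of_ae_eq (μ := MeasureTheory.volume) ?_ isOpen_Ioo
      hc.continuousOn continuousOn_const
    exact (MeasureTheory.ae_restrict_iff' measurableSet_Ioo).2 hae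
  exact h2 ⟨by norm_num, by norm_num⟩

/-! ### The final argument -/

theorem Test.mono_set {S T : Set ℝ} {f : ℝ → ℝ} (h : Test S f) (hST : S ⊆ T) : Test T f :=
  ⟨h.sm, h.cpt, h.sub.trans hST⟩

theorem Test.wide {f : ℝ → ℝ} (h : Test (Set.Ioo 0 2) f) : Test (Set.Ioo (-2) 2) f :=
  h.mono_set (Set.Ioo_subset_Ioo_left (by norm_num))

theorem Test.zero_notMem {f : ℝ → ℝ} (h : Test (Set.Ioo 0 2) f) : (0 : ℝ) ∉ tsupport f :=
  fun h0 => lt_irrefl _ (h.sub h0).1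

theorem pairS_vanish {N n : ℕ} {P : (Fin N → ℕ) → (Fin N → ℝ) → ℝ} {p q : Fin N → ℝ}
    {f : Fin N → ℝ → ℝ} (hf : ∀ m, ContDiff ℝ (⊤ : ℕ∞) (f m)) (m : Fin N)
    (hm : q m - p m ∉ tsupport (f m)) : pairS n P (prodFn p f) q = 0 :=
  pairS_zero fun I => by
    rw [pdMulti_prodFn_zero hf I m (deriv_iter_zero hm _), mul_zero]

theorem pairS_prod {N n : ℕ} {P : (Fin N → ℕ) → (Fin N → ℝ) → ℝ} (hP : Fam n P)
    {p q : Fin N → ℝ}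
    {f : Fin N → ℝ → ℝ} (hf : ∀ m, ContDiff ℝ (⊤ : ℕ∞) (f m)) (K : Fin N → ℕ)
    (h : ∀ I, ∀ m, I m ≠ K m → P I q = 0 ∨ deriv^[I m] (f m) (q m - p m) = 0) :
    pairS n P (prodFn p f) q = P K q * ∏ m, deriv^[K m] (f m) (q m - p m) := by
  rw [pairS_single hP K, pdMulti_prodFn p hf]
  · rfl
  · intro I hI
    obtain ⟨m, hm⟩ := Function.ne_iff.1 hI
    rcases h I m hm with h0 | h0
    · rw [h0, zero_mul]
    · rw [pdMulti_prodFn_zero hf I m h0, mul_zero]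

section final
variable {N n : ℕ} {L : Fin N → Fin N → JetSpace N n → ℝ} {u : (Fin N → ℝ) → ℝ}

/-- The flower identity for product test functions. -/
def FlowerId (L : Fin N → Fin N → JetSpace N n → ℝ) (u : (Fin N → ℝ) → ℝ) : Prop :=
  ∀ (p : Fin N → ℝ) (i j k : Fin N), i ≠ j → j ≠ k → i ≠ k →
    ∀ f : Fin N → ℝ → ℝ, (∀ m, Test (Set.Ioo (-2) 2) (f m)) →
      petalVar L u (prodFn p f) p i j 2 2 + petalVar L u (prodFn p f) p j k 2 2
        + petalVar L u (prodFn p f) p k i 2 2 = 0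

theorem exists_third (hN : 3 ≤ N) (i j : Fin N) : ∃ k : Fin N, i ≠ k ∧ j ≠ k := by
  have : ({i, j} : Finset (Fin N)).card < Fintype.card (Fin N) := by
    rw [Fintype.card_fin]
    exact lt_of_le_of_lt Finset.card_le_two (by omega)
  obtain ⟨k, hk⟩ := Finset.exists_mem_notMem_of_card_lt_card
    (s := ({i, j} : Finset (Fin N))) (t := Finset.univ) (by simpa using this)
  have := hk.2
  simp only [Finset.mem_insert, Finset.mem_singleton, not_or] at this
  exact ⟨k, fun h => this.1 h.symm, fun h => this.2 h.symm⟩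

theorem step1 (hN : 3 ≤ N) (hL : ∀ i j, ContDiff ℝ (⊤ : ℕ∞) (L i j)) (hu : Sm u)
    (H : FlowerId L u) (i j : Fin N) (hij : i ≠ j) (K : Fin N → ℕ) (hKi : K i = 0) (hKj : K j = 0)
    (t₀ : Fin N → ℝ) : varDer2 i j (L i j) K u t₀ = 0 := by
  obtain ⟨k, hik, hjk⟩ := exists_third hN i j
  have hE : Continuous (varDer2 i j (L i j) K u) := ((Fam.varDer2 (hL i j) hu i j).sm K).continuous
  set E := varDer2 i j (L i j) K u with hEdef
  set p : Fin N → ℝ := t₀ - unitVec i - unitVec j with hp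
  have key : ∀ g₁, Test (Set.Ioo 0 2) g₁ → ∀ g₂, Test (Set.Ioo 0 2) g₂ →
      ∫ s in (0:ℝ)..2, (∫ t in (0:ℝ)..2, E (p + s • unitVec i + t • unitVec j) * g₂ t) * g₁ s = 0 := by
    intro g₁ hg₁ g₂ hg₂
    let f : Fin N → ℝ → ℝ := fun m => if m = i then g₁ else if m = j then g₂ else mono (K m)
    have hfi : f i = g₁ := if_pos rfl
    have hfj : f j = g₂ := by simp only [f, if_neg hij.symm, if_true]
    have hfm : ∀ m, m ≠ i → m ≠ j → f m = mono (K m) := fun m h1 h2 => by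
      simp only [f, if_neg h1, if_neg h2]
    have hf : ∀ m, Test (Set.Ioo (-2) 2) (f m) := by
      intro m
      by_cases h1 : m = i
      · rw [h1, hfi]; exact hg₁.wide
      by_cases h2 : m = j
      · rw [h2, hfj]; exact hg₂.wide
      rw [hfm m h1 h2]; exact mono_test _
    have hfs := fun m => (hf m).sm
    have vi : ∀ (P : (Fin N → ℕ) → (Fin N → ℝ) → ℝ) (q : Fin N → ℝ), q i - p i = 0 →
        pairS n P (prodFn p f) q = 0 := fun P q hq =>
      pairS_vanish hfs i (by rw [hq, hfi]; exact hg₁.zero_notMem)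
    have vj : ∀ (P : (Fin N → ℕ) → (Fin N → ℝ) → ℝ) (q : Fin N → ℝ), q j - p j = 0 →
        pairS n P (prodFn p f) q = 0 := fun P q hq =>
      pairS_vanish hfs j (by rw [hq, hfj]; exact hg₂.zero_notMem)
    have ui : ∀ (P : (Fin N → ℕ) → (Fin N → ℝ) → ℝ) (s : ℝ),
        pairS n P (prodFn p f) (p + s • unitVec i) = 0 := fun P s =>
      vj P _ (by simp [unitVec, Pi.single_eq_of_ne hij.symm])
    have uj : ∀ (P : (Fin N → ℕ) → (Fin N → ℝ) → ℝ) (s : ℝ),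
        pairS n P (prodFn p f) (p + s • unitVec j) = 0 := fun P s =>
      vi P _ (by simp [unitVec, Pi.single_eq_of_ne hij])
    have uk : ∀ (P : (Fin N → ℕ) → (Fin N → ℝ) → ℝ) (s : ℝ),
        pairS n P (prodFn p f) (p + s • unitVec k) = 0 := fun P s =>
      vi P _ (by simp [unitVec, Pi.single_eq_of_ne hik])
    have u0 : ∀ (P : (Fin N → ℕ) → (Fin N → ℝ) → ℝ),
        pairS n P (prodFn p f) p = 0 := fun P => vi P _ (sub_self _)
    have ujk : ∀ (P : (Fin N → ℕ) → (Fin N → ℝ) → ℝ) (s t : ℝ),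
        pairS n P (prodFn p f) (p + s • unitVec j + t • unitVec k) = 0 := fun P s t =>
      vi P _ (by simp [unitVec, Pi.single_eq_of_ne hij, Pi.single_eq_of_ne hik])
    have uki : ∀ (P : (Fin N → ℕ) → (Fin N → ℝ) → ℝ) (s t : ℝ),
        pairS n P (prodFn p f) (p + s • unitVec k + t • unitVec i) = 0 := fun P s t =>
      vj P _ (by simp [unitVec, Pi.single_eq_of_ne hij.symm, Pi.single_eq_of_ne hjk])
    have uij : ∀ s t : ℝ, pairS n (famZ L u i j) (prodFn p f) (p + s • unitVec i + t • unitVec j)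
        = E (p + s • unitVec i + t • unitVec j) * g₂ t * g₁ s := by
      intro s t
      have qi : (p + s • unitVec i + t • unitVec j : Fin N → ℝ) i - p i = s := by
        simp [unitVec, Pi.single_eq_of_ne hij]
      have qj : (p + s • unitVec i + t • unitVec j : Fin N → ℝ) j - p j = t := by
        simp [unitVec, Pi.single_eq_of_ne hij.symm]
      have qm : ∀ m, m ≠ i → m ≠ j →
          (p + s • unitVec i + t • unitVec j : Fin N → ℝ) m - p m = 0 := fun m h1 h2 => by
        simp [unitVec, Pi.single_eq_of_ne h1, Pi.single_eq_of_ne h2]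
      rw [pairS_prod (famZ_fam i j hL hu) hfs K]
      · have hz : famZ L u i j K = E := by
          simp only [famZ, hKi, hKj, if_true, hEdef]
        rw [hz, Finset.prod_eq_mul i j hij, qi, qj, hKi, hKj, hfi, hfj]
        · simp only [Function.iterate_zero, id_eq]
          ring
        · intro m _ hm
          rw [qm m hm.1 hm.2, hfm m hm.1 hm.2, mono_deriv, if_pos rfl]
        · intro h; exact absurd (Finset.mem_univ _) h
        · intro h; exact absurd (Finset.mem_univ _) h
      · intro I m hm
        by_cases h1 : m = i
        · left
          rw [h1, hKi] at hm
          simp only [famZ, if_neg hm, Pi.zero_apply]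
        by_cases h2 : m = j
        · left
          rw [h2, hKj] at hm
          simp only [famZ, if_neg hm, ite_self, Pi.zero_apply]
        right
        rw [qm m h1 h2, hfm m h1 h2, mono_deriv, if_neg hm]
    have h := H p i j k hij hjk hik f hf
    unfold petalVar at h
    simp only [uij, ujk, uki, ui, uj, uk, u0, intervalIntegral.integral_zero, sub_zero, add_zero] at h
    simp only [intervalIntegral.integral_mul_const] at h
    exact h
  have key2 : ∀ g₂, Test (Set.Ioo 0 2) g₂ →
      ∫ t in (0:ℝ)..2, E (p + (1:ℝ) • unitVec i + t • unitVec j) * g₂ t = 0 := by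
    intro g₂ hg₂
    refine fund_lemma (h := fun s : ℝ =>
      ∫ t in (0:ℝ)..2, E (p + s • unitVec i + t • unitVec j) * g₂ t) ?_ (fun g₁ hg₁ => key g₁ hg₁ g₂ hg₂)
    apply intervalIntegral.continuous_parametric_intervalIntegral_of_continuous'
    have := hg₂.sm.continuous
    simp only [Function.uncurry_def]
    fun_prop
  have h1 := fund_lemma (h := fun t : ℝ => E (p + (1:ℝ) • unitVec i + t • unitVec j))
    (by fun_prop) key2
  have e : p + (1:ℝ) • unitVec i + (1:ℝ) • unitVec j = t₀ := by
    rw [hp, one_smul, one_smul]; abel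
  simp only [e] at h1
  exact h1

theorem step2 (hL : ∀ i j, ContDiff ℝ (⊤ : ℕ∞) (L i j)) (hu : Sm u)
    (H : FlowerId L u) (hZ : ∀ i j : Fin N, i ≠ j → ∀ I t, famZ L u i j I t = 0)
    (i j k : Fin N) (hij : i ≠ j) (hjk : j ≠ k) (hik : i ≠ k) (K : Fin N → ℕ) (hKi : K i = 0)
    (t₀ : Fin N → ℝ) : famY L u i j K t₀ + famX L u k i K t₀ = 0 := by
  have hE : Continuous (fun t => famY L u i j K t + famX L u k i K t) :=
    ((famY_fam i j hL hu).sm K).continuous.add ((famX_fam k i hL hu).sm K).continuous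
  have cY := ((famY_fam i j hL hu).sm K).continuous
  have cX := ((famX_fam k i hL hu).sm K).continuous
  set p : Fin N → ℝ := t₀ - unitVec i with hp
  have key : ∀ g, Test (Set.Ioo 0 2) g →
      ∫ s in (0:ℝ)..2, (famY L u i j K (p + s • unitVec i) + famX L u k i K (p + s • unitVec i)) * g s
        = 0 := by
    intro g hg
    let f : Fin N → ℝ → ℝ := fun m => if m = i then g else mono (K m)
    have hfi : f i = g := if_pos rfl
    have hfm : ∀ m, m ≠ i → f m = mono (K m) := fun m h1 => by
      simp only [f, if_neg h1]
    have hf : ∀ m, Test (Set.Ioo (-2) 2) (f m) := by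
      intro m
      by_cases h1 : m = i
      · rw [h1, hfi]; exact hg.wide
      rw [hfm m h1]; exact mono_test _
    have hfs := fun m => (hf m).sm
    have vi : ∀ (P : (Fin N → ℕ) → (Fin N → ℝ) → ℝ) (q : Fin N → ℝ), q i - p i = 0 →
        pairS n P (prodFn p f) q = 0 := fun P q hq =>
      pairS_vanish hfs i (by rw [hq, hfi]; exact hg.zero_notMem)
    have uj : ∀ (P : (Fin N → ℕ) → (Fin N → ℝ) → ℝ) (s : ℝ),
        pairS n P (prodFn p f) (p + s • unitVec j) = 0 := fun P s =>
      vi P _ (by simp [unitVec, Pi.single_eq_of_ne hij])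
    have uk : ∀ (P : (Fin N → ℕ) → (Fin N → ℝ) → ℝ) (s : ℝ),
        pairS n P (prodFn p f) (p + s • unitVec k) = 0 := fun P s =>
      vi P _ (by simp [unitVec, Pi.single_eq_of_ne hik])
    have u0 : ∀ (P : (Fin N → ℕ) → (Fin N → ℝ) → ℝ),
        pairS n P (prodFn p f) p = 0 := fun P => vi P _ (sub_self _)
    have hz : ∀ i j : Fin N, i ≠ j → ∀ q, pairS n (famZ L u i j) (prodFn p f) q = 0 := fun i j h q =>
      pairS_zero fun I => by rw [hZ i j h, zero_mul]
    have ui : ∀ (P : (Fin N → ℕ) → (Fin N → ℝ) → ℝ), Fam n P → (∀ I, I i ≠ 0 → P I = 0) → ∀ s : ℝ,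
        pairS n P (prodFn p f) (p + s • unitVec i) = P K (p + s • unitVec i) * g s := by
      intro P hP hP0 s
      have qi : (p + s • unitVec i : Fin N → ℝ) i - p i = s := by simp [unitVec]
      have qm : ∀ m, m ≠ i → (p + s • unitVec i : Fin N → ℝ) m - p m = 0 := fun m h1 => by
        simp [unitVec, Pi.single_eq_of_ne h1]
      rw [pairS_prod hP hfs K]
      · rw [Finset.prod_eq_single i, qi, hKi, hfi]
        · rfl
        · intro m _ hm
          rw [qm m hm, hfm m hm, mono_deriv, if_pos rfl]
        · intro h; exact absurd (Finset.mem_univ _) h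
      · intro I m hm
        by_cases h1 : m = i
        · left
          rw [h1, hKi] at hm
          rw [hP0 I hm, Pi.zero_apply]
        right
        rw [qm m h1, hfm m h1, mono_deriv, if_neg hm]
    have uY := ui _ (famY_fam i j hL hu) (fun I hI => by simp only [famY, if_neg hI])
    have uX := ui _ (famX_fam k i hL hu) (fun I hI => by simp only [famX, if_neg hI])
    have h := H p i j k hij hjk hik f hf
    unfold petalVar at h
    simp only [uY, uX, uj, uk, u0, hz i j hij, hz j k hjk, hz k i hik.symm,
      intervalIntegral.integral_zero, sub_zero, add_zero, zero_sub] at h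
    have cg := hg.sm.continuous
    simp only [add_mul]
    rw [intervalIntegral.integral_add]
    · linarith
    · exact Continuous.intervalIntegrable (by fun_prop) _ _
    · exact Continuous.intervalIntegrable (by fun_prop) _ _
  have h1 := fund_lemma (h := fun s : ℝ =>
    famY L u i j K (p + s • unitVec i) + famX L u k i K (p + s • unitVec i)) (by fun_prop) key
  have e : p + (1:ℝ) • unitVec i = t₀ := by
    rw [hp, one_smul]; abel
  simp only [e] at h1
  exact h1

theorem step3 (hL : ∀ i j, ContDiff ℝ (⊤ : ℕ∞) (L i j)) (hu : Sm u)
    (H : FlowerId L u) (hZ : ∀ i j : Fin N, i ≠ j → ∀ I t, famZ L u i j I t = 0)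
    (hY : ∀ i j k : Fin N, i ≠ j → j ≠ k → i ≠ k → ∀ I t, famY L u i j I t + famX L u k i I t = 0)
    (i j k : Fin N) (hij : i ≠ j) (hjk : j ≠ k) (hik : i ≠ k) (K : Fin N → ℕ)
    (p : Fin N → ℝ) : famW L u i j K p + famW L u j k K p + famW L u k i K p = 0 := by
  let f : Fin N → ℝ → ℝ := fun m => mono (K m)
  have hf : ∀ m, Test (Set.Ioo (-2) 2) (f m) := fun m => mono_test _
  have hfs := fun m => (hf m).sm
  have ui : ∀ (P : (Fin N → ℕ) → (Fin N → ℝ) → ℝ), Fam n P →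
        pairS n P (prodFn p f) p = P K p := by
    intro P hP
    rw [pairS_prod hP hfs K, Finset.prod_eq_one, mul_one]
    · intro m _
      rw [sub_self, mono_deriv, if_pos rfl]
    · intro I m hm
      right
      rw [sub_self, mono_deriv, if_neg hm]
  have h := H p i j k hij hjk hik f hf
  rw [flower_of_EL12 hZ hY p hij hjk hik, ui _ (famW_fam i j hL hu), ui _ (famW_fam j k hL hu),
    ui _ (famW_fam k i hL hu)] at h
  exact h

end final

/-- multi-time Euler–Lagrange equations for two-dimensional surfaces.
For a Lagrangian 2-form `(L_{ij})` (with `L_{ji} = −L_{ij}`) of jet order `n` and a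
smooth field `u`, stationarity of the action on every 3-flower, under all smooth
compactly supported variations whose support avoids the outer edges of the three petals,
is equivalent to the multi-time Euler–Lagrange equations
`δ_{ij}L_{ij}/δu_I = 0` (for `I_i = I_j = 0`),
`δ_{ij}L_{ij}/δu_{Ij} = δ_{ik}L_{ik}/δu_{Ik}` (for `I_i = 0`) and
`δ_{ij}L_{ij}/δu_{Iij} + δ_{jk}L_{jk}/δu_{Ijk} + δ_{ki}L_{ki}/δu_{Iki} = 0`. -/
theorem stmt_1 (N n : ℕ) (hN : 3 ≤ N)
    (L : Fin N → Fin N → JetSpace N n → ℝ) (hLsmooth : ∀ i j, ContDiff ℝ (⊤ : ℕ∞) (L i j))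
    (hLanti : ∀ i j, L j i = -L i j)
    (u : (Fin N → ℝ) → ℝ) (hu : ContDiff ℝ (⊤ : ℕ∞) u) :
    (∀ (p : Fin N → ℝ) (i j k : Fin N), i ≠ j → j ≠ k → i ≠ k →
      ∀ ai aj ak : ℝ, 0 < ai → 0 < aj → 0 < ak →
      ∀ φ : (Fin N → ℝ) → ℝ, ContDiff ℝ (⊤ : ℕ∞) φ → HasCompactSupport φ →
        Disjoint (tsupport φ)
          (petalOuter p i j ai aj ∪ petalOuter p j k aj ak ∪ petalOuter p k i ak ai) →
        deriv (fun ε : ℝ =>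
          petalAction L (u + ε • φ) p i j ai aj
          + petalAction L (u + ε • φ) p j k aj ak
          + petalAction L (u + ε • φ) p k i ak ai) 0 = 0)
    ↔
    ((∀ i j : Fin N, i ≠ j → ∀ I : Fin N → ℕ, I i = 0 → I j = 0 →
        ∀ t : Fin N → ℝ, varDer2 i j (L i j) I u t = 0) ∧
      (∀ i j k : Fin N, i ≠ j → j ≠ k → i ≠ k → ∀ I : Fin N → ℕ, I i = 0 →
        ∀ t : Fin N → ℝ,
          varDer2 i j (L i j) (I + Pi.single j 1) u t
            = varDer2 i k (L i k) (I + Pi.single k 1) u t) ∧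
      (∀ i j k : Fin N, i ≠ j → j ≠ k → i ≠ k → ∀ I : Fin N → ℕ, ∀ t : Fin N → ℝ,
          varDer2 i j (L i j) (I + Pi.single i 1 + Pi.single j 1) u t
            + varDer2 j k (L j k) (I + Pi.single j 1 + Pi.single k 1) u t
            + varDer2 k i (L k i) (I + Pi.single k 1 + Pi.single i 1) u t = 0)) := by
  have conv : ∀ (i k : Fin N) (J : Fin N → ℕ) (t : Fin N → ℝ),
      varDer2 k i (L k i) J u t = - varDer2 i k (L i k) J u t := by
    intro i k J t
    have e := varDer2_anti (hLsmooth i k) (hLanti i k) hu i k J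
    rw [e, Pi.neg_apply]
  constructor
  · intro H
    have HF : FlowerId L u := by
      intro p i j k hij hjk hik f hf
      have hφ : Sm (prodFn p f) := prodFn_sm p fun m => (hf m).sm
      have hd := prodFn_disjoint p hf hij hjk hik
      rw [← flower_deriv hLsmooth hu hφ p hij hjk hik two_pos two_pos two_pos hd]
      exact H p i j k hij hjk hik 2 2 2 two_pos two_pos two_pos _ hφ
        (prodFn_cpt p fun m => (hf m).cpt) hd
    have h1 := step1 hN hLsmooth hu HF
    have hZ : ∀ i j : Fin N, i ≠ j → ∀ I t, famZ L u i j I t = 0 := by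
      intro i j hij I t
      unfold famZ
      split_ifs with hi hj
      · exact h1 i j hij I hi hj t
      · rfl
      · rfl
    have h2 := step2 hLsmooth hu HF hZ
    have hY : ∀ i j k : Fin N, i ≠ j → j ≠ k → i ≠ k → ∀ I t,
        famY L u i j I t + famX L u k i I t = 0 := by
      intro i j k hij hjk hik I t
      by_cases hi : I i = 0
      · exact h2 i j k hij hjk hik I hi t
      · simp only [famY, famX, if_neg hi, Pi.zero_apply, add_zero]
    refine ⟨h1, ?_, step3 hLsmooth hu HF hZ hY⟩
    intro i j k hij hjk hik I hi t
    have h := h2 i j k hij hjk hik I hi t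
    simp only [famY, famX, if_pos hi] at h
    have e := conv i k (I + Pi.single k 1) t
    linarith
  · rintro ⟨h1, h2, h3⟩ p i j k hij hjk hik ai aj ak hai haj hak φ hφ _ hd
    have hZ : ∀ i j : Fin N, i ≠ j → ∀ I t, famZ L u i j I t = 0 := by
      intro i j hij I t
      unfold famZ
      split_ifs with hi hj
      · exact h1 i j hij I hi hj t
      · rfl
      · rfl
    have hY : ∀ i j k : Fin N, i ≠ j → j ≠ k → i ≠ k → ∀ I t,
        famY L u i j I t + famX L u k i I t = 0 := by
      intro i j k hij hjk hik I t
      by_cases hi : I i = 0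
      · simp only [famY, famX, if_pos hi]
        have h := h2 i j k hij hjk hik I hi t
        have e := conv i k (I + Pi.single k 1) t
        linarith
      · simp only [famY, famX, if_neg hi, Pi.zero_apply, add_zero]
    rw [flower_deriv hLsmooth hu hφ p hij hjk hik hai haj hak hd,
      flower_of_EL12 hZ hY p hij hjk hik]
    unfold pairS
    rw [Finset.sum_apply, Finset.sum_apply, Finset.sum_apply, ← Finset.sum_add_distrib,
      ← Finset.sum_add_distrib]
    apply Finset.sum_eq_zero
    intro I _
    have h := h3 i j k hij hjk hik I p
    simp only [Pi.mul_apply, famW]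
    linear_combination (pdMulti I φ p) * h
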